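/- arXiv:2602.22281 — 2 statements merged into one kernel-verified Lean document; each statement's English description precedes it below -/
import Mathlib

section
/- Let 𝒯 be a set of t ≥ 2 rooted binary phylogenetic trees on X, let k_r be a positive integer, let r = min{max{k_r,3}, t+1}, let C' = (x_1,…,x_m) be a common m-chain of 𝒯 with m > r, and let 𝒯_C be the result of applying the chain reduction rule (replacing each T ∈ 𝒯 by T|X_C where X_C = X ∖ {x_{r+1},…,x_m}). Then 𝒯_C has a rooted agreement forest of size at most k_r if and only if 𝒯 has a rooted agreement forest of size at most k_r. -/
/-- A rooted binary phylogenetic tree on taxon set `X`: a finite directed tree with all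
edges directed away from the root, whose root has in-degree 0 (and out-degree 2 unless
it is itself the unique leaf), whose leaves (out-degree 0) are bijectively labelled by
`X`, and whose remaining vertices have in-degree 1 and out-degree 2. -/
structure RTree (X : Type) : Type 1 where
  V : Type
  finV : Finite V
  E : V → V → Prop
  root : V
  label : X → V
  label_inj : Function.Injective label
  reach_root : ∀ v : V, Relation.ReflTransGen E root v
  not_into_root : ∀ u : V, ¬ E u root
  leaf_iff : ∀ v : V, {w : V | E v w} = ∅ ↔ v ∈ Set.range label
  out_two : ∀ v : V, v ∉ Set.range label → {w : V | E v w}.ncard = 2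
  in_one : ∀ v : V, v ≠ root → {u : V | E u v}.ncard = 1

namespace RTree

variable {X : Type}

/-- `u` is an ancestor of (or equal to) `v`. -/
def anc (T : RTree X) (u v : T.V) : Prop := Relation.ReflTransGen T.E u v

/-- Vertex set of the minimal subtree `T[B]` of `T` spanning the leaves labelled by `B`:
the vertices that are ancestors of some leaf in `B` and descendants of every common
ancestor of all leaves in `B`. -/
def spanSet (T : RTree X) (B : Set X) : Set T.V :=
  {v | (∃ x ∈ B, T.anc v (T.label x)) ∧
    ∀ w : T.V, (∀ x ∈ B, T.anc w (T.label x)) → T.anc w v}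

/-- `deg^T(B)`: the number of edges of `T` with exactly one endpoint in `T[B]`. -/
noncomputable def blockDeg (T : RTree X) (B : Set X) : ℕ :=
  {p : T.V × T.V | T.E p.1 p.2 ∧
    Xor' (p.1 ∈ T.spanSet B) (p.2 ∈ T.spanSet B)}.ncard

/-- The vertices of `T[B]` surviving the suppression of in-degree-1 out-degree-1
vertices: the leaves labelled by `B` together with the branch points of `T[B]`. -/
def keepSet (T : RTree X) (B : Set X) : Set T.V :=
  {v | v ∈ T.spanSet B ∧
    (v ∈ T.label '' B ∨ 2 ≤ ({w : T.V | T.E v w} ∩ T.spanSet B).ncard)}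

/-- Adjacency in the suppressed tree `T|B`: `v` is reachable from `u` by a directed path
inside `T[B]` containing no other surviving vertex internally. -/
def restAdj (T : RTree X) (B : Set X) (u v : T.V) : Prop :=
  u ∈ T.keepSet B ∧ v ∈ T.keepSet B ∧ u ≠ v ∧
    Relation.ReflTransGen
      (fun a b => T.E a b ∧ b ∈ T.spanSet B ∧ (b = v ∨ b ∉ T.keepSet B)) u v

/-- `T|B = T'|B`: a leaf-label-preserving isomorphism between the suppressed trees
respecting edge directions. -/
def restEq (T T' : RTree X) (B : Set X) : Prop :=
  ∃ φ : T.V → T'.V, Set.BijOn φ (T.keepSet B) (T'.keepSet B) ∧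
    (∀ x ∈ B, φ (T.label x) = T'.label x) ∧
    ∀ u v : T.V, u ∈ T.keepSet B → v ∈ T.keepSet B →
      (T.restAdj B u v ↔ T'.restAdj B (φ u) (φ v))

/-- `F` is a partition of `X` into nonempty blocks. -/
def IsForestPartition (F : Set (Set X)) : Prop :=
  (∀ B ∈ F, B.Nonempty) ∧ ∀ x : X, ∃! B, B ∈ F ∧ x ∈ B

/-- A rooted agreement forest for `𝒯`: a partition of `X` whose blocks have a common
topology in all trees and induce pairwise vertex-disjoint subtrees in each tree. -/
def IsAgreementForest (𝒯 : Set (RTree X)) (F : Set (Set X)) : Prop :=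
  IsForestPartition F ∧
  (∀ B ∈ F, ∀ T ∈ 𝒯, ∀ T' ∈ 𝒯, restEq T T' B) ∧
  ∀ B ∈ F, ∀ B' ∈ F, B ≠ B' → ∀ T ∈ 𝒯, Disjoint (T.spanSet B) (T.spanSet B')

/-- `(x 0, …, x (m-1))` is a chain in the rooted tree `T`, with `x 0` closest to the
root: the parent of each `x i` is equal to, or the parent of, the parent of `x (i+1)`. -/
def IsChainIn (T : RTree X) {m : ℕ} (x : Fin m → X) : Prop :=
  ∀ (i : ℕ) (h1 : i + 1 < m), ∀ p q : T.V,
    T.E p (T.label (x ⟨i, Nat.lt_of_succ_lt h1⟩)) →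
    T.E q (T.label (x ⟨i + 1, h1⟩)) → p = q ∨ T.E p q

/-- A common `m`-chain of `𝒯`: a sequence of `m ≥ 2` distinct taxa that is a chain in
every tree of `𝒯`. -/
def IsCommonChain (𝒯 : Set (RTree X)) {m : ℕ} (x : Fin m → X) : Prop :=
  2 ≤ m ∧ Function.Injective x ∧ ∀ T ∈ 𝒯, T.IsChainIn x

/-- `T[S]` is pendant in `T`: there is an edge `(u,v)` such that the leaves below `v`
are exactly those labelled by `S`. -/
def IsPendant (T : RTree X) (S : Set X) : Prop :=
  ∃ u v : T.V, T.E u v ∧ ∀ x : X, (T.anc v (T.label x) ↔ x ∈ S)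

/-- A label-preserving isomorphism between `T[S]` and `T'[S]` respecting directions. -/
def pendantIso (T T' : RTree X) (S : Set X) : Prop :=
  ∃ φ : T.V → T'.V, Set.BijOn φ (T.spanSet S) (T'.spanSet S) ∧
    (∀ x ∈ S, φ (T.label x) = T'.label x) ∧
    ∀ u v : T.V, u ∈ T.spanSet S → v ∈ T.spanSet S →
      (T.E u v ↔ T'.E (φ u) (φ v))

/-- `S` induces a common pendant subtree of `𝒯`. -/
def InducesCommonPendant (𝒯 : Set (RTree X)) (S : Set X) : Prop :=
  S.Nonempty ∧ (∀ T ∈ 𝒯, IsPendant T S) ∧ ∀ T ∈ 𝒯, ∀ T' ∈ 𝒯, pendantIso T T' S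

/-- `T'` is (isomorphic to) the restriction `T|X'` of `T` to the taxa in `X'`. -/
def IsRestrictionOf (T : RTree X) (X' : Set X) (T' : RTree X') : Prop :=
  ∃ φ : T'.V → T.V, Function.Injective φ ∧
    (∀ x : X', φ (T'.label x) = T.label x.val) ∧
    Set.range φ = T.keepSet X' ∧
    ∀ u v : T'.V, T'.E u v ↔ T.restAdj X' (φ u) (φ v)

/-- `𝒯' = { T|X' : T ∈ 𝒯 }` up to label-preserving isomorphism. -/
def IsRestrictionFamily (𝒯 : Set (RTree X)) (X' : Set X) (𝒯' : Set (RTree X')) : Prop :=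
  (∀ T' ∈ 𝒯', ∃ T ∈ 𝒯, IsRestrictionOf T X' T') ∧
  ∀ T ∈ 𝒯, ∃ T' ∈ 𝒯', IsRestrictionOf T X' T'

/-- The subtree reduction rule is applicable: some `S` with `|S| ≥ 2` induces a common
pendant subtree. -/
def SubtreeRuleApplicable (𝒯 : Set (RTree X)) : Prop :=
  ∃ S : Set X, 2 ≤ S.ncard ∧ InducesCommonPendant 𝒯 S

/-- The chain reduction rule (with truncation length `r`) is applicable: `𝒯` has a
common `m`-chain with `m > r`. -/
def ChainRuleApplicable (𝒯 : Set (RTree X)) (r : ℕ) : Prop :=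
  ∃ (m : ℕ) (x : Fin m → X), r < m ∧ IsCommonChain 𝒯 x

end RTree

namespace RTree

variable {X : Type}

/-- `ab|c` (weakly): some vertex is above `a` and `b` but not above `c`. -/
def rt (T : RTree X) (a b c : X) : Prop :=
  ∃ v : T.V, T.anc v (T.label a) ∧ T.anc v (T.label b) ∧ ¬ T.anc v (T.label c)

theorem parent_unique (T : RTree X) {u u' v : T.V} (h : T.E u v) (h' : T.E u' v) : u = u' := by
  have hv : v ≠ T.root := by
    rintro rfl
    exact T.not_into_root _ h
  obtain ⟨w, hw⟩ := Set.ncard_eq_one.mp (T.in_one v hv)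
  have h1 : u ∈ ({u | T.E u v} : Set T.V) := h
  have h2 : u' ∈ ({u | T.E u v} : Set T.V) := h'
  rw [hw] at h1 h2
  simp at h1 h2
  rw [h1, h2]

theorem acyclic (T : RTree X) (v : T.V) : ¬ Relation.TransGen T.E v v := by
  have := T.reach_root v
  induction this with
  | refl =>
    intro h
    obtain ⟨u, _, hu⟩ := Relation.TransGen.tail'_iff.mp h
    exact T.not_into_root _ hu
  | tail _ hbc ih =>
    intro h
    obtain ⟨u, h1, hu⟩ := Relation.TransGen.tail'_iff.mp h
    have := T.parent_unique hu hbc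
    subst this
    exact ih (Relation.TransGen.head' hbc h1)

theorem anc_refl (T : RTree X) (v : T.V) : T.anc v v := Relation.ReflTransGen.refl

theorem anc_trans (T : RTree X) {u v w : T.V} (h : T.anc u v) (h' : T.anc v w) : T.anc u w :=
  Relation.ReflTransGen.trans h h'

theorem anc_of_E (T : RTree X) {u v : T.V} (h : T.E u v) : T.anc u v :=
  Relation.ReflTransGen.single h

theorem anc_antisymm (T : RTree X) {u v : T.V} (h : T.anc u v) (h' : T.anc v u) : u = v := by
  by_contra hne
  rcases Relation.reflTransGen_iff_eq_or_transGen.mp h with h1 | h1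
  · exact hne h1.symm
  · exact T.acyclic _ (Relation.TransGen.trans_left h1 h')

theorem not_anc_of_E (T : RTree X) {u v : T.V} (h : T.E u v) : ¬ T.anc v u := fun h' =>
  T.acyclic _ (Relation.TransGen.head' h h')

theorem anc_total (T : RTree X) {u v w : T.V} (h : T.anc u w) (h' : T.anc v w) :
    T.anc u v ∨ T.anc v u := by
  induction h' with
  | refl => exact Or.inl h
  | tail hvb hbc ih =>
    rcases Relation.ReflTransGen.cases_tail h with h1 | ⟨b', h1, h2⟩
    · right
      rw [← h1]
      exact hvb.tail hbc
    · have := T.parent_unique h2 hbc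
      subst this
      exact ih h1

theorem anc_parent (T : RTree X) {w b c : T.V} (h : T.anc w c) (hbc : T.E b c) :
    w = c ∨ T.anc w b := by
  rcases Relation.ReflTransGen.cases_tail h with h1 | ⟨b', h1, h2⟩
  · exact Or.inl h1.symm
  · have := T.parent_unique h2 hbc
    subst this
    exact Or.inr h1

theorem anc_child (T : RTree X) {u v : T.V} (h : T.anc u v) (hne : u ≠ v) :
    ∃ e, T.E u e ∧ T.anc e v := by
  rcases Relation.ReflTransGen.cases_head h with h1 | h1
  · exact absurd h1 hne
  · exact h1

theorem label_no_child (T : RTree X) (a : X) (v : T.V) : ¬ T.E (T.label a) v := by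
  intro h
  have := (T.leaf_iff (T.label a)).mpr ⟨a, rfl⟩
  have h1 : v ∈ ({w | T.E (T.label a) w} : Set T.V) := h
  rw [this] at h1
  exact h1

theorem anc_label (T : RTree X) {a : X} {v : T.V} (h : T.anc (T.label a) v) : v = T.label a := by
  by_contra hne
  obtain ⟨e, he, _⟩ := T.anc_child h (Ne.symm hne)
  exact T.label_no_child _ _ he

theorem anc_label_label (T : RTree X) {a b : X} (h : T.anc (T.label a) (T.label b)) : a = b :=
  (T.label_inj (T.anc_label h)).symm

/-- siblings are incomparable -/
theorem sib (T : RTree X) {p e e' z : T.V} (h : T.E p e) (h' : T.E p e') (hz : T.anc e z)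
    (hz' : T.anc e' z) : e = e' := by
  have key : ∀ {e e' : T.V}, T.E p e → T.E p e' → T.anc e e' → e = e' := by
    intro e e' h h' h1
    rcases T.anc_parent h1 h' with h2 | h2
    · exact h2
    · exact absurd h2 (T.not_anc_of_E h)
  rcases T.anc_total hz hz' with h1 | h1
  · exact key h h' h1
  · exact (key h' h h1).symm

theorem wf_up (T : RTree X) : WellFounded (fun u v : T.V => T.anc u v ∧ u ≠ v) := by
  have := T.finV
  have : IsTrans T.V (fun u v : T.V => T.anc u v ∧ u ≠ v) := ⟨by
    rintro a b c ⟨h1, h2⟩ ⟨h3, h4⟩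
    refine ⟨T.anc_trans h1 h3, ?_⟩
    rintro rfl
    exact h2 (T.anc_antisymm h1 h3)⟩
  have : Std.Irrefl (fun u v : T.V => T.anc u v ∧ u ≠ v) := ⟨by
    rintro a ⟨_, h⟩
    exact h rfl⟩
  exact Finite.wellFounded_of_trans_of_irrefl _

theorem wf_down (T : RTree X) : WellFounded (fun u v : T.V => T.anc v u ∧ u ≠ v) := by
  have := T.finV
  have : IsTrans T.V (fun u v : T.V => T.anc v u ∧ u ≠ v) := ⟨by
    rintro a b c ⟨h1, h2⟩ ⟨h3, h4⟩
    refine ⟨T.anc_trans h3 h1, ?_⟩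
    rintro rfl
    exact h2 (T.anc_antisymm h3 h1)⟩
  have : Std.Irrefl (fun u v : T.V => T.anc v u ∧ u ≠ v) := ⟨by
    rintro a ⟨_, h⟩
    exact h rfl⟩
  exact Finite.wellFounded_of_trans_of_irrefl _

/-- among a nonempty set of ancestors of `z` there is a lowest one -/
theorem exists_lowest (T : RTree X) (S : Set T.V) (hS : S.Nonempty) (z : T.V)
    (hz : ∀ w ∈ S, T.anc w z) : ∃ v ∈ S, ∀ w ∈ S, T.anc w v := by
  obtain ⟨v, hv, hmin⟩ := T.wf_down.has_min S hS
  refine ⟨v, hv, fun w hw => ?_⟩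
  rcases T.anc_total (hz w hw) (hz v hv) with h | h
  · exact h
  · by_cases he : w = v
    · rw [he]; exact T.anc_refl _
    · exact absurd ⟨h, he⟩ (hmin w hw)

theorem exists_highest (T : RTree X) (S : Set T.V) (hS : S.Nonempty) (z : T.V)
    (hz : ∀ w ∈ S, T.anc w z) : ∃ v ∈ S, ∀ w ∈ S, T.anc v w := by
  obtain ⟨v, hv, hmin⟩ := T.wf_up.has_min S hS
  refine ⟨v, hv, fun w hw => ?_⟩
  rcases T.anc_total (hz v hv) (hz w hw) with h | h
  · exact h
  · by_cases he : w = v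
    · rw [he]; exact T.anc_refl _
    · exact absurd ⟨h, he⟩ (hmin w hw)

/-- `v` is the lowest common ancestor of `a` and `b` -/
def isLca (T : RTree X) (a b : X) (v : T.V) : Prop :=
  T.anc v (T.label a) ∧ T.anc v (T.label b) ∧
    ∀ w, T.anc w (T.label a) → T.anc w (T.label b) → T.anc w v

theorem exists_lca (T : RTree X) (a b : X) : ∃ v, T.isLca a b v := by
  obtain ⟨v, hv, h⟩ := T.exists_lowest {w | T.anc w (T.label a) ∧ T.anc w (T.label b)}
    ⟨T.root, T.reach_root _, T.reach_root _⟩ (T.label a) (fun w hw => hw.1)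
  exact ⟨v, hv.1, hv.2, fun w h1 h2 => h w ⟨h1, h2⟩⟩

theorem rt_iff_lca (T : RTree X) {a b c : X} {v : T.V} (h : T.isLca a b v) :
    T.rt a b c ↔ ¬ T.anc v (T.label c) := by
  constructor
  · rintro ⟨w, h1, h2, h3⟩ h4
    exact h3 (T.anc_trans (h.2.2 w h1 h2) h4)
  · intro h4
    exact ⟨v, h.1, h.2.1, h4⟩

theorem rt_symm (T : RTree X) {a b c : X} (h : T.rt a b c) : T.rt b a c := by
  obtain ⟨v, h1, h2, h3⟩ := h
  exact ⟨v, h2, h1, h3⟩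

theorem rt_self (T : RTree X) {a c : X} : T.rt a a c ↔ a ≠ c := by
  constructor
  · rintro ⟨v, h1, h2, h3⟩ rfl
    exact h3 h1
  · intro h
    exact ⟨T.label a, T.anc_refl _, T.anc_refl _, fun h' => h (T.anc_label_label h')⟩

theorem rt_trans (T : RTree X) {a b d c : X} (h : T.rt a b c) (h' : T.rt b d c) : T.rt a d c := by
  obtain ⟨v, h1, h2, h3⟩ := h
  obtain ⟨w, g1, g2, g3⟩ := h'
  rcases T.anc_total h2 g1 with h | h
  · exact ⟨v, h1, T.anc_trans h g2, h3⟩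
  · exact ⟨w, T.anc_trans h h1, g2, g3⟩

theorem rt_split (T : RTree X) {a b c : X} (d : X) (h : T.rt a b c) : T.rt a b d ∨ T.rt a d c := by
  obtain ⟨v, h1, h2, h3⟩ := h
  by_cases hd : T.anc v (T.label d)
  · exact Or.inr ⟨v, h1, hd, h3⟩
  · exact Or.inl ⟨v, h1, h2, hd⟩

theorem rt_not (T : RTree X) {a b c : X} (h : T.rt a b c) : ¬ T.rt a c b := by
  obtain ⟨v, h1, h2, h3⟩ := h
  rintro ⟨w, g1, g2, g3⟩
  rcases T.anc_total h1 g1 with h | h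
  · exact h3 (T.anc_trans h g2)
  · exact g3 (T.anc_trans h h2)

theorem disjoint_iff (T : RTree X) (B B' : Set X) :
    Disjoint (T.spanSet B) (T.spanSet B') ↔
      ∀ a ∈ B, ∀ b ∈ B, ∀ c ∈ B', ∀ d ∈ B', T.rt a b c ∨ T.rt c d a := by
  constructor
  · intro h a ha b hb c hc d hd
    by_contra hcon
    push Not at hcon
    obtain ⟨h1, h2⟩ := hcon
    obtain ⟨v, hv⟩ := T.exists_lca a c
    have k1 : v ∈ T.spanSet B := by
      refine ⟨⟨a, ha, hv.1⟩, fun w hw => hv.2.2 w (hw a ha) ?_⟩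
      by_contra hn
      exact h1 ⟨w, hw a ha, hw b hb, hn⟩
    have k2 : v ∈ T.spanSet B' := by
      refine ⟨⟨c, hc, hv.2.1⟩, fun w hw => hv.2.2 w ?_ (hw c hc)⟩
      by_contra hn
      exact h2 ⟨w, hw c hc, hw d hd, hn⟩
    exact Set.disjoint_left.mp h k1 k2
  · intro h
    rw [Set.disjoint_left]
    have key : ∀ (B : Set X) (v : T.V) (a c : X), v ∈ T.spanSet B → a ∈ B → T.anc v (T.label a) →
        T.anc v (T.label c) → ∃ b ∈ B, ¬ T.rt a b c := by
      intro B v a c hv ha hva hvc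
      by_cases hne : ({w | T.anc w (T.label a) ∧ ¬ T.anc w (T.label c)} : Set T.V).Nonempty
      · obtain ⟨W, hW, hmax⟩ := T.exists_highest _ hne (T.label a) (fun w hw => hw.1)
        by_cases hall : ∀ b ∈ B, T.anc W (T.label b)
        · exact absurd (T.anc_trans (hv.2 W hall) hvc) hW.2
        · push Not at hall
          obtain ⟨b, hb, hWb⟩ := hall
          refine ⟨b, hb, ?_⟩
          rintro ⟨w, h1, h2, h3⟩
          exact hWb (T.anc_trans (hmax w ⟨h1, h3⟩) h2)
      · refine ⟨a, ha, ?_⟩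
        rintro ⟨w, h1, h2, h3⟩
        exact hne ⟨w, h1, h3⟩
    intro v hv hv'
    obtain ⟨a, ha, hva⟩ := hv.1
    obtain ⟨c, hc, hvc⟩ := hv'.1
    obtain ⟨b, hb, h1⟩ := key B v a c hv ha hva hvc
    obtain ⟨d, hd, h2⟩ := key B' v c a hv' hc hvc hva
    rcases h a ha b hb c hc d hd with h | h
    · exact h1 h
    · exact h2 h

theorem keep_iff (T : RTree X) (B : Set X) (v : T.V) :
    v ∈ T.keepSet B ↔ ∃ a ∈ B, ∃ b ∈ B, T.isLca a b v := by
  have := T.finV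
  constructor
  · rintro ⟨hs, h | h⟩
    · obtain ⟨a, ha, rfl⟩ := h
      exact ⟨a, ha, a, ha, T.anc_refl _, T.anc_refl _, fun w h _ => h⟩
    · obtain ⟨e1, he1, e2, he2, hne⟩ := (Set.one_lt_ncard (Set.toFinite _)).mp h
      obtain ⟨a, ha, h1⟩ := he1.2.1
      obtain ⟨b, hb, h2⟩ := he2.2.1
      have hE1 : T.E v e1 := he1.1
      have hE2 : T.E v e2 := he2.1
      have hva := T.anc_trans (T.anc_of_E hE1) h1
      have hvb := T.anc_trans (T.anc_of_E hE2) h2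
      refine ⟨a, ha, b, hb, hva, hvb, fun w hwa hwb => ?_⟩
      rcases T.anc_total hwa hva with h | h
      · exact h
      · by_cases hvw : v = w
        · rw [hvw]; exact T.anc_refl _
        · obtain ⟨e, he, hew⟩ := T.anc_child h hvw
          have k1 := T.sib hE1 he h1 (T.anc_trans hew hwa)
          have k2 := T.sib hE2 he h2 (T.anc_trans hew hwb)
          exact absurd (k1.trans k2.symm) hne
  · rintro ⟨a, ha, b, hb, h1, h2, h3⟩
    have hs : v ∈ T.spanSet B := ⟨⟨a, ha, h1⟩, fun w hw => h3 w (hw a ha) (hw b hb)⟩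
    refine ⟨hs, ?_⟩
    by_cases hva : v = T.label a
    · exact Or.inl ⟨a, ha, hva.symm⟩
    by_cases hvb : v = T.label b
    · exact Or.inl ⟨b, hb, hvb.symm⟩
    right
    obtain ⟨e1, hE1, g1⟩ := T.anc_child h1 hva
    obtain ⟨e2, hE2, g2⟩ := T.anc_child h2 hvb
    refine (Set.one_lt_ncard (Set.toFinite _)).mpr ⟨e1, ⟨hE1, ⟨a, ha, g1⟩, ?_⟩, e2,
      ⟨hE2, ⟨b, hb, g2⟩, ?_⟩, ?_⟩
    · intro w hw
      exact T.anc_trans (hs.2 w hw) (T.anc_of_E hE1)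
    · intro w hw
      exact T.anc_trans (hs.2 w hw) (T.anc_of_E hE2)
    · rintro rfl
      exact T.not_anc_of_E hE1 (h3 _ g1 g2)

theorem restAdj_iff (T : RTree X) (B : Set X) (u v : T.V) :
    T.restAdj B u v ↔ u ∈ T.keepSet B ∧ v ∈ T.keepSet B ∧ u ≠ v ∧ T.anc u v ∧
      ∀ w ∈ T.keepSet B, T.anc u w → T.anc w v → w = u ∨ w = v := by
  constructor
  · rintro ⟨hu, hv, hne, h⟩
    refine ⟨hu, hv, hne, Relation.ReflTransGen.mono (fun a b h => h.1) _ _ h, ?_⟩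
    have key : ∀ z, Relation.ReflTransGen
      (fun a b => T.E a b ∧ b ∈ T.spanSet B ∧ (b = v ∨ b ∉ T.keepSet B)) u z →
        ∀ w, T.anc u w → T.anc w z → w = u ∨ w = v ∨ w ∉ T.keepSet B := by
      intro z hz
      induction hz with
      | refl => exact fun w h1 h2 => Or.inl (T.anc_antisymm h2 h1)
      | tail _ hbc ih =>
        intro w h1 h2
        rcases T.anc_parent h2 hbc.1 with h | h
        · subst h
          exact Or.inr hbc.2.2
        · exact ih w h1 h
    intro w hw h1 h2
    rcases key v h w h1 h2 with h | h | h
    · exact Or.inl h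
    · exact Or.inr h
    · exact absurd hw h
  · rintro ⟨hu, hv, hne, h, hc⟩
    refine ⟨hu, hv, hne, ?_⟩
    have key : ∀ z, T.anc u z → T.anc z v → Relation.ReflTransGen
      (fun a b => T.E a b ∧ b ∈ T.spanSet B ∧ (b = v ∨ b ∉ T.keepSet B)) u z := by
      intro z hz
      induction hz with
      | refl => exact fun _ => Relation.ReflTransGen.refl
      | @tail b c hub hbc ih =>
        intro hcv
        have huc : T.anc u c := hub.tail hbc
        refine (ih (T.anc_trans (T.anc_of_E hbc) hcv)).tail ⟨hbc, ⟨?_, ?_⟩, ?_⟩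
        · obtain ⟨x, hx, h1⟩ := hv.1.1
          exact ⟨x, hx, T.anc_trans hcv h1⟩
        · intro w hw
          exact T.anc_trans (hu.1.2 w hw) huc
        · by_cases hk : c ∈ T.keepSet B
          · rcases hc c hk huc hcv with h | h
            · subst h
              exact absurd hub (T.not_anc_of_E hbc)
            · exact Or.inl h
          · exact Or.inr hk
    exact key v h (T.anc_refl _)

theorem anc_iff_restAdj (T : RTree X) (B : Set X) (u v : T.V) (hu : u ∈ T.keepSet B)
    (hv : v ∈ T.keepSet B) : T.anc u v ↔ Relation.ReflTransGen (T.restAdj B) u v := by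
  constructor
  · induction v using T.wf_up.induction with
    | _ v ih =>
      intro h
      by_cases hne : u = v
      · rw [hne]
      obtain ⟨w, hw, hlow⟩ := T.exists_lowest
        {w | w ∈ T.keepSet B ∧ T.anc u w ∧ T.anc w v ∧ w ≠ v} ⟨u, hu, T.anc_refl _, h, hne⟩ v
        (fun w hw => hw.2.2.1)
      refine (ih w ⟨hw.2.2.1, hw.2.2.2⟩ hw.1 hw.2.1).tail ?_
      rw [restAdj_iff]
      refine ⟨hw.1, hv, hw.2.2.2, hw.2.2.1, fun z hz h1 h2 => ?_⟩
      by_cases hzv : z = v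
      · exact Or.inr hzv
      · left
        exact T.anc_antisymm (hlow z ⟨hz, T.anc_trans hw.2.1 h1, h2, hzv⟩) h1
  · intro h
    induction h with
    | refl => exact T.anc_refl _
    | @tail b c _ hbc ih =>
      have := (T.restAdj_iff B b c).mp hbc
      exact T.anc_trans (ih this.1) this.2.2.2.1

theorem label_keep (T : RTree X) {B : Set X} {a : X} (ha : a ∈ B) : T.label a ∈ T.keepSet B :=
  (T.keep_iff B _).mpr ⟨a, ha, a, ha, T.anc_refl _, T.anc_refl _, fun _ h _ => h⟩

theorem rt_keep (T : RTree X) {B : Set X} {a b c : X} (ha : a ∈ B) (hb : b ∈ B) :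
    T.rt a b c ↔ ∃ v ∈ T.keepSet B, T.anc v (T.label a) ∧ T.anc v (T.label b) ∧
      ¬ T.anc v (T.label c) := by
  constructor
  · intro h
    obtain ⟨v, hv⟩ := T.exists_lca a b
    exact ⟨v, (T.keep_iff B v).mpr ⟨a, ha, b, hb, hv⟩, hv.1, hv.2.1, (T.rt_iff_lca hv).mp h⟩
  · rintro ⟨v, _, h⟩
    exact ⟨v, h⟩

theorem rt_of_restEq {T T' : RTree X} {B : Set X} (h : restEq T T' B) :
    ∀ a ∈ B, ∀ b ∈ B, ∀ c ∈ B, T.rt a b c ↔ T'.rt a b c := by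
  obtain ⟨φ, hbij, hlab, hadj⟩ := h
  have hmap : ∀ u ∈ T.keepSet B, φ u ∈ T'.keepSet B := fun u hu => hbij.mapsTo hu
  have f1 : ∀ u v, u ∈ T.keepSet B → Relation.ReflTransGen (T.restAdj B) u v →
      Relation.ReflTransGen (T'.restAdj B) (φ u) (φ v) := by
    intro u v hu h
    induction h with
    | refl => exact Relation.ReflTransGen.refl
    | tail _ hbc ih => exact ih.tail ((hadj _ _ hbc.1 hbc.2.1).mp hbc)
  have f2 : ∀ u v', u ∈ T.keepSet B → Relation.ReflTransGen (T'.restAdj B) (φ u) v' →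
      ∃ v ∈ T.keepSet B, φ v = v' ∧ Relation.ReflTransGen (T.restAdj B) u v := by
    intro u v' hu h
    induction h with
    | refl => exact ⟨u, hu, rfl, Relation.ReflTransGen.refl⟩
    | @tail b c _ hbc ih =>
      obtain ⟨v, hv, rfl, h1⟩ := ih
      obtain ⟨w, hw, rfl⟩ := hbij.surjOn hbc.2.1
      exact ⟨w, hw, rfl, h1.tail ((hadj _ _ hv hw).mpr hbc)⟩
  have hanc : ∀ u v, u ∈ T.keepSet B → v ∈ T.keepSet B → (T.anc u v ↔ T'.anc (φ u) (φ v)) := by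
    intro u v hu hv
    rw [T.anc_iff_restAdj B u v hu hv, T'.anc_iff_restAdj B _ _ (hmap u hu) (hmap v hv)]
    constructor
    · exact f1 u v hu
    · intro h
      obtain ⟨w, hw, h1, h2⟩ := f2 u _ hu h
      rw [← hbij.injOn hw hv h1]
      exact h2
  intro a ha b hb c hc
  have hl : ∀ u ∈ T.keepSet B, ∀ x ∈ B, (T.anc u (T.label x) ↔ T'.anc (φ u) (T'.label x)) := by
    intro u hu x hx
    rw [hanc u _ hu (T.label_keep hx), hlab x hx]
  rw [T.rt_keep ha hb, T'.rt_keep ha hb]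
  constructor
  · rintro ⟨v, hv, h1, h2, h3⟩
    exact ⟨φ v, hmap v hv, (hl v hv a ha).mp h1, (hl v hv b hb).mp h2,
      fun h => h3 ((hl v hv c hc).mpr h)⟩
  · rintro ⟨v', hv', h1, h2, h3⟩
    obtain ⟨v, hv, rfl⟩ := hbij.surjOn hv'
    exact ⟨v, hv, (hl v hv a ha).mpr h1, (hl v hv b hb).mpr h2,
      fun h => h3 ((hl v hv c hc).mp h)⟩

theorem anc_iff_cluster (T : RTree X) {B : Set X} {u v : T.V} (hv : v ∈ T.keepSet B) :
    T.anc u v ↔ ∀ c ∈ B, T.anc v (T.label c) → T.anc u (T.label c) := by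
  constructor
  · intro h c _ hc
    exact T.anc_trans h hc
  · intro h
    obtain ⟨a, ha, b, hb, hl⟩ := (T.keep_iff B v).mp hv
    exact hl.2.2 u (h a ha hl.1) (h b hb hl.2.1)

theorem restEq_of_rt {T T' : RTree X} {B : Set X}
    (h : ∀ a ∈ B, ∀ b ∈ B, ∀ c ∈ B, T.rt a b c ↔ T'.rt a b c) : restEq T T' B := by
  classical
  have step : ∀ (T T' : RTree X), (∀ a ∈ B, ∀ b ∈ B, ∀ c ∈ B, T.rt a b c ↔ T'.rt a b c) →
      ∀ v ∈ T.keepSet B, ∃ v' ∈ T'.keepSet B, ∀ c ∈ B,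
        (T.anc v (T.label c) ↔ T'.anc v' (T'.label c)) := by
    intro T T' h v hv
    obtain ⟨a, ha, b, hb, hl⟩ := (T.keep_iff B v).mp hv
    obtain ⟨v', hl'⟩ := T'.exists_lca a b
    refine ⟨v', (T'.keep_iff B v').mpr ⟨a, ha, b, hb, hl'⟩, fun c hc => ?_⟩
    have := h a ha b hb c hc
    rw [T.rt_iff_lca hl, T'.rt_iff_lca hl'] at this
    exact not_iff_not.mp this
  choose f hf hf' using step T T' h
  have hcl : ∀ (T : RTree X) (u v : T.V), u ∈ T.keepSet B → v ∈ T.keepSet B →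
      (∀ c ∈ B, (T.anc u (T.label c) ↔ T.anc v (T.label c))) → u = v := by
    intro T u v hu hv huv
    exact T.anc_antisymm ((T.anc_iff_cluster hv).mpr fun c hc => (huv c hc).mpr)
      ((T.anc_iff_cluster hu).mpr fun c hc => (huv c hc).mp)
  let φ : T.V → T'.V := fun v => if hv : v ∈ T.keepSet B then f v hv else T'.root
  have hφ : ∀ v, v ∈ T.keepSet B → φ v ∈ T'.keepSet B := by
    intro v hv
    simp only [φ, dif_pos hv]
    exact hf v hv
  have hφ' : ∀ v, v ∈ T.keepSet B → ∀ c ∈ B,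
        (T.anc v (T.label c) ↔ T'.anc (φ v) (T'.label c)) := by
    intro v hv
    simp only [φ, dif_pos hv]
    exact hf' v hv
  have hsurj : ∀ v' ∈ T'.keepSet B, ∃ v ∈ T.keepSet B, φ v = v' := by
    intro v' hv'
    obtain ⟨v, hv, h1⟩ := step T' T (fun a ha b hb c hc => (h a ha b hb c hc).symm) v' hv'
    exact ⟨v, hv, hcl T' _ _ (hφ v hv) hv' fun c hc => by rw [← hφ' v hv c hc, h1 c hc]⟩
  have hinj : ∀ u ∈ T.keepSet B, ∀ v ∈ T.keepSet B, φ u = φ v → u = v := by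
    intro u hu v hv huv
    exact hcl T u v hu hv fun c hc => by rw [hφ' u hu c hc, hφ' v hv c hc, huv]
  have hanc : ∀ u ∈ T.keepSet B, ∀ v ∈ T.keepSet B, (T.anc u v ↔ T'.anc (φ u) (φ v)) := by
    intro u hu v hv
    rw [T.anc_iff_cluster hv, T'.anc_iff_cluster (hφ v hv)]
    exact forall₂_congr fun c hc => by rw [hφ' u hu c hc, hφ' v hv c hc]
  refine ⟨φ, ⟨fun v hv => hφ v hv, fun u hu v hv => hinj u hu v hv, fun v' hv' => hsurj v' hv'⟩,
    ?_, ?_⟩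
  · intro x hx
    have h1 := (hφ' _ (T.label_keep hx) x hx).mp (T.anc_refl _)
    refine T'.anc_antisymm h1 ?_
    rw [T'.anc_iff_cluster (hφ _ (T.label_keep hx))]
    intro c hc hc'
    have := T.anc_label_label ((hφ' _ (T.label_keep hx) c hc).mpr hc')
    rw [this]
    exact T'.anc_refl _
  · intro u v hu hv
    rw [restAdj_iff, restAdj_iff]
    constructor
    · rintro ⟨_, _, h1, h2, h3⟩
      refine ⟨hφ u hu, hφ v hv, fun h => h1 (hinj u hu v hv h), (hanc u hu v hv).mp h2, ?_⟩
      intro w' hw' g1 g2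
      obtain ⟨w, hw, rfl⟩ := hsurj w' hw'
      rcases h3 w hw ((hanc u hu w hw).mpr g1) ((hanc w hw v hv).mpr g2) with h | h
      · exact Or.inl (by rw [h])
      · exact Or.inr (by rw [h])
    · rintro ⟨_, _, h1, h2, h3⟩
      refine ⟨hu, hv, fun h => h1 (by rw [h]), (hanc u hu v hv).mpr h2, ?_⟩
      intro w hw g1 g2
      rcases h3 (φ w) (hφ w hw) ((hanc u hu w hw).mp g1) ((hanc w hw v hv).mp g2) with h | h
      · exact Or.inl (hinj w hw u hu h)
      · exact Or.inr (hinj w hw v hv h)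

theorem restEq_iff {T T' : RTree X} {B : Set X} : restEq T T' B ↔
    ∀ a ∈ B, ∀ b ∈ B, ∀ c ∈ B, T.rt a b c ↔ T'.rt a b c :=
  ⟨rt_of_restEq, restEq_of_rt⟩

theorem rt_restriction {T : RTree X} {X' : Set X} {T' : RTree X'} (h : IsRestrictionOf T X' T')
    (a b c : X') : T'.rt a b c ↔ T.rt a b c := by
  obtain ⟨φ, hinj, hlab, hrange, hE⟩ := h
  have hk : ∀ u, φ u ∈ T.keepSet X' := by
    intro u
    rw [← hrange]
    exact ⟨u, rfl⟩
  have hanc : ∀ u v, T'.anc u v ↔ T.anc (φ u) (φ v) := by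
    intro u v
    rw [T.anc_iff_restAdj X' _ _ (hk u) (hk v)]
    constructor
    · intro h
      induction h with
      | refl => exact Relation.ReflTransGen.refl
      | tail _ hbc ih => exact ih.tail ((hE _ _).mp hbc)
    · intro h
      have f2 : ∀ v', Relation.ReflTransGen (T.restAdj X') (φ u) v' →
          ∃ v, φ v = v' ∧ T'.anc u v := by
        intro v' h
        induction h with
        | refl => exact ⟨u, rfl, Relation.ReflTransGen.refl⟩
        | @tail b c _ hbc ih =>
          obtain ⟨v, rfl, h1⟩ := ih
          have hc : c ∈ Set.range φ := by
            rw [hrange]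
            exact hbc.2.1
          obtain ⟨w, rfl⟩ := hc
          exact ⟨w, rfl, Relation.ReflTransGen.tail h1 ((hE _ _).mpr hbc)⟩
      obtain ⟨w, h1, h2⟩ := f2 _ h
      rw [← hinj h1]
      exact h2
  rw [T.rt_keep a.2 b.2]
  constructor
  · rintro ⟨v, h1, h2, h3⟩
    rw [hanc, hlab] at h1 h2 h3
    exact ⟨φ v, hk v, h1, h2, h3⟩
  · rintro ⟨v', hv', h1, h2, h3⟩
    rw [← hrange] at hv'
    obtain ⟨v, rfl⟩ := hv'
    rw [← hlab, ← hanc] at h1 h2 h3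
    exact ⟨v, h1, h2, h3⟩

end RTree
namespace RTree

variable {X : Type}

theorem chain_facts (T : RTree X) {m : ℕ} (x : Fin m → X) (hm : 3 ≤ m)
    (hinj : Function.Injective x) (hc : T.IsChainIn x) :
    ∃ D : X → Prop, (∀ y, D y → y ∉ Set.range x) ∧
      (∀ i j k, i < j → i < k → T.rt (x j) (x k) (x i)) ∧
      (∀ y ∉ Set.range x, ¬ D y → ∀ i j, T.rt (x i) (x j) y) ∧
      (∀ y, D y → ∀ i j, i < j → T.rt y (x j) (x i)) ∧
      (∀ y y', D y → D y' → ∀ i, T.rt y y' (x i)) := by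
  have hnr : ∀ i, T.label (x i) ≠ T.root := by
    intro i h
    have h0 : ∀ j, x i = x j := by
      intro j
      have := T.reach_root (T.label (x j))
      rw [← h] at this
      exact T.anc_label_label this
    have h1 := hinj ((h0 ⟨0, by omega⟩).symm.trans (h0 ⟨1, by omega⟩))
    simp at h1
  have hpar : ∀ i, ∃ p, T.E p (T.label (x i)) := by
    intro i
    obtain ⟨p, hp⟩ := Set.ncard_eq_one.mp (T.in_one _ (hnr i))
    exact ⟨p, by
      have : p ∈ ({u | T.E u (T.label (x i))} : Set T.V) := by rw [hp]; rfl
      exact this⟩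
  choose p hp using hpar
  have hq : ∀ i, ∃ q, T.E (p i) q ∧ q ≠ T.label (x i) ∧
      ∀ e, T.E (p i) e → e = T.label (x i) ∨ e = q := by
    intro i
    have hn : p i ∉ Set.range T.label := by
      rintro ⟨a, ha⟩
      have := hp i
      rw [← ha] at this
      exact T.label_no_child _ _ this
    obtain ⟨a, b, hab, hs⟩ := Set.ncard_eq_two.mp (T.out_two _ hn)
    have hs' : ∀ e, T.E (p i) e ↔ e = a ∨ e = b := by
      intro e
      have : e ∈ ({w | T.E (p i) w} : Set T.V) ↔ e ∈ ({a, b} : Set T.V) := by rw [hs]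
      simpa using this
    rcases (hs' _).mp (hp i) with h | h
    · refine ⟨b, (hs' b).mpr (Or.inr rfl), ?_, ?_⟩
      · rw [h]; exact hab.symm
      · intro e he
        rw [h]
        exact (hs' e).mp he
    · refine ⟨a, (hs' a).mpr (Or.inl rfl), ?_, ?_⟩
      · rw [h]; exact hab
      · intro e he
        rw [h]
        exact ((hs' e).mp he).symm
  choose q hqE hqne hqall using hq
  have hnext : ∀ (i : ℕ) (h : i + 1 < m), q ⟨i, by omega⟩ = p ⟨i + 1, h⟩ ∨
      (q ⟨i, by omega⟩ = T.label (x ⟨i + 1, h⟩) ∧ p ⟨i, by omega⟩ = p ⟨i + 1, h⟩) := by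
    intro i h
    rcases hc i h _ _ (hp _) (hp _) with h1 | h1
    · right
      refine ⟨?_, h1⟩
      have h2 := hp ⟨i + 1, h⟩
      rw [← h1] at h2
      rcases hqall _ _ h2 with h3 | h3
      · have := hinj (T.label_inj h3)
        simp at this
      · exact h3.symm
    · left
      rcases hqall _ _ h1 with h3 | h3
      · have h4 := hp ⟨i + 1, h⟩
        rw [h3] at h4
        exact absurd h4 (T.label_no_child _ _)
      · exact h3.symm
  have hnext' : ∀ (i : ℕ) (h : i + 2 < m), q ⟨i, by omega⟩ = p ⟨i + 1, by omega⟩ := by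
    intro i h
    rcases hnext i (by omega) with h1 | ⟨_, h1⟩
    · exact h1
    · exfalso
      have h2 := hp ⟨i, by omega⟩
      rw [h1] at h2
      rcases hqall _ _ h2 with h3 | h3
      · have := hinj (T.label_inj h3)
        simp at this
      · rcases hnext (i + 1) h with h4 | ⟨h4, _⟩
        · have h5 := hp ⟨i + 2, h⟩
          rw [← h4, ← h3] at h5
          exact T.label_no_child _ _ h5
        · rw [← h3] at h4
          have := hinj (T.label_inj h4)
          simp at this
          omega
  have hpanc : ∀ (j : ℕ) (hj : j < m) (i : ℕ) (hi : i ≤ j),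
      T.anc (p ⟨i, by omega⟩) (p ⟨j, hj⟩) := by
    intro j
    induction j with
    | zero =>
      intro hj i hi
      have : i = 0 := by omega
      subst this
      exact T.anc_refl _
    | succ j ih =>
      intro hj i hi
      rcases Nat.lt_or_ge i (j + 1) with h | h
      · refine T.anc_trans (ih (by omega) i (by omega)) ?_
        rcases hnext j hj with h1 | ⟨_, h1⟩
        · rw [← h1]
          exact T.anc_of_E (hqE _)
        · rw [h1]
          exact T.anc_refl _
      · have : i = j + 1 := by omega
        subst this
        exact T.anc_refl _
  have hqx : ∀ i j : Fin m, i < j → T.anc (q i) (T.label (x j)) := by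
    rintro ⟨i, hi⟩ ⟨j, hj⟩ hij
    have hij : i < j := hij
    rcases Nat.lt_or_ge (i + 1) j with h | h
    · rw [hnext' i (by omega)]
      exact T.anc_trans (hpanc j hj (i + 1) (by omega)) (T.anc_of_E (hp _))
    · have : j = i + 1 := by omega
      subst this
      rcases hnext i hj with h1 | ⟨h1, _⟩
      · rw [h1]
        exact T.anc_of_E (hp _)
      · rw [h1]
        exact T.anc_refl _
  have hqn : ∀ i, ¬ T.anc (q i) (T.label (x i)) := by
    intro i h
    exact hqne i (T.sib (hqE i) (hp i) h (T.anc_refl _))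
  have hp0 : ∀ j, T.anc (p ⟨0, by omega⟩) (T.label (x j)) := fun j =>
    T.anc_trans (hpanc j.1 j.2 0 (by omega)) (T.anc_of_E (hp _))
  have hdown : ∀ i y, y ∉ Set.range x → T.anc (p i) (T.label y) → T.anc (q i) (T.label y) := by
    intro i y hy h
    have hne : p i ≠ T.label y := by
      intro h'
      have h1 := hp i
      rw [h'] at h1
      exact T.label_no_child _ _ h1
    obtain ⟨e, he, he'⟩ := T.anc_child h hne
    rcases hqall i e he with h1 | h1
    · rw [h1] at he'
      exact absurd ⟨i, T.anc_label_label he'⟩ hy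
    · rw [← h1]
      exact he'
  have hD : ∀ y, y ∉ Set.range x → T.anc (p ⟨0, by omega⟩) (T.label y) →
      ∀ (i : ℕ) (hi : i < m), T.anc (p ⟨i, hi⟩) (T.label y) := by
    intro y hy h i
    induction i with
    | zero => exact fun _ => h
    | succ i ih =>
      intro hi
      have h1 := hdown _ y hy (ih (by omega))
      rcases hnext i hi with h2 | ⟨h2, _⟩
      · rw [← h2]
        exact h1
      · rw [h2] at h1
        exact absurd ⟨_, T.anc_label_label h1⟩ hy
  refine ⟨fun y => y ∉ Set.range x ∧ T.anc (p ⟨0, by omega⟩) (T.label y), fun y hy => hy.1,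
    ?_, ?_, ?_, ?_⟩
  · intro i j k hj hk
    exact ⟨q i, hqx i j hj, hqx i k hk, hqn i⟩
  · intro y hy hn i j
    exact ⟨_, hp0 i, hp0 j, fun h => hn ⟨hy, h⟩⟩
  · intro y hy i j hij
    exact ⟨q i, hdown i y hy.1 (hD y hy.1 hy.2 i.1 i.2), hqx i j hij, hqn i⟩
  · intro y y' hy hy' i
    exact ⟨q i, hdown i y hy.1 (hD y hy.1 hy.2 i.1 i.2),
      hdown i y' hy'.1 (hD y' hy'.1 hy'.2 i.1 i.2), hqn i⟩

end RTree
/-- A tree-like ternary relation together with a chain `x` and the set `D` of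
non-chain taxa lying below the chain. -/
structure ChainRel {X : Type} {m : ℕ} (x : Fin m → X) (R : X → X → X → Prop)
    (D : X → Prop) : Prop where
  symm : ∀ {a b c}, R a b c → R b a c
  self : ∀ {a c}, a ≠ c → R a a c
  irr : ∀ {a b}, ¬ R a b a
  trans : ∀ {a b d c}, R a b c → R b d c → R a d c
  split : ∀ {a b c} (d), R a b c → R a b d ∨ R a d c
  nt : ∀ {a b c}, R a b c → ¬ R a c b
  inj : Function.Injective x
  dC : ∀ {y}, D y → ∀ i, y ≠ x i
  cc : ∀ {i j k}, i < j → i < k → R (x j) (x k) (x i)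
  u : ∀ {y}, (∀ i, y ≠ x i) → ¬ D y → ∀ i j, R (x i) (x j) y
  d1 : ∀ {y}, D y → ∀ {i j}, i < j → R y (x j) (x i)
  d2 : ∀ {y y'}, D y → D y' → ∀ i, R y y' (x i)

namespace ChainRel

variable {X : Type} {m : ℕ} {x : Fin m → X} {R : X → X → X → Prop} {D : X → Prop}

theorem irr' (h : ChainRel x R D) {a b : X} : ¬ R a b b := fun h' => h.irr (h.symm h')

theorem d3 (h : ChainRel x R D) (hm : 2 ≤ m) {y z : X} (hy : D y) (hz : ∀ i, z ≠ x i)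
    (hzD : ¬ D z) (i : Fin m) : R y (x i) z := by
  have h01 : (⟨0, by omega⟩ : Fin m) < ⟨1, by omega⟩ := by simp
  have h1 := h.d1 hy h01
  have h2 := h.u hz hzD
  rcases h.split z h1 with h3 | h3
  · exact h.trans h3 (h2 _ _)
  · have h4 := h.trans (h.symm h3) h1
    exact absurd (h.symm h4) (h.nt (h2 _ _))

theorem d4 (h : ChainRel x R D) (hm : 2 ≤ m) {y y' z : X} (hy : D y) (hy' : D y')
    (hz : ∀ i, z ≠ x i) (hzD : ¬ D z) : R y y' z :=
  h.trans (h.d3 hm hy hz hzD ⟨0, by omega⟩) (h.symm (h.d3 hm hy' hz hzD ⟨0, by omega⟩))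

theorem sub1 (h : ChainRel x R D) {i : Fin m} (j : Fin m) {b z : X} (hz : ∀ i, z ≠ x i)
    (hzD : ¬ D z) (h1 : R (x i) b z) : R (x j) b z :=
  h.trans (h.u hz hzD j i) h1

theorem sub2 (h : ChainRel x R D) {i : Fin m} (j : Fin m) {b z : X} (hz : ∀ i, z ≠ x i)
    (hzD : ¬ D z) (h1 : R z b (x i)) : R z b (x j) := by
  rcases h.split (x j) h1 with h2 | h2
  · exact h2
  · exact absurd (h.symm h2) (h.nt (h.u hz hzD j i))

/-- classification `D y` by a triple -/
theorem D_iff (h : ChainRel x R D) {y : X} (hy : ∀ i, y ≠ x i) {i j : Fin m} (hij : i < j) :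
    D y ↔ R y (x j) (x i) := by
  constructor
  · exact fun hd => h.d1 hd hij
  · intro h1
    by_contra hd
    exact h.nt (h.symm h1) (h.u hy hd j i)

theorem agree_union {P Q : X → X → X → Prop} {DP DQ : X → Prop} (hP : ChainRel x P DP)
    (hQ : ChainRel x Q DQ) (hm : 2 ≤ m) {B : Set X} {i j : Fin m} (hij : i < j) (hi : x i ∈ B)
    (hj : x j ∈ B) (hPQ : ∀ a ∈ B, ∀ b ∈ B, ∀ c ∈ B, P a b c ↔ Q a b c) :
    ∀ a ∈ B ∪ Set.range x, ∀ b ∈ B ∪ Set.range x, ∀ c ∈ B ∪ Set.range x, P a b c → Q a b c := by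
  have cls : ∀ y ∈ B ∪ Set.range x, (∃ k, y = x k) ∨ (y ∈ B ∧ DP y ∧ DQ y) ∨
      (y ∈ B ∧ (∀ i, y ≠ x i) ∧ ¬ DP y ∧ ¬ DQ y) := by
    intro y hy
    by_cases hC : ∃ k, y = x k
    · exact Or.inl hC
    · push Not at hC
      have hyB : y ∈ B := by
        rcases hy with h | ⟨k, h⟩
        · exact h
        · exact absurd h.symm (hC k)
      have h1 := hP.D_iff hC hij
      have h2 := hQ.D_iff hC hij
      rw [hPQ y hyB _ hj _ hi, ← h2] at h1
      right
      by_cases hD : DP y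
      · exact Or.inl ⟨hyB, hD, h1.mp hD⟩
      · exact Or.inr ⟨hyB, hC, hD, fun h => hD (h1.mpr h)⟩
  intro a ha b hb c hc h
  rcases cls c hc with ⟨kc, rfl⟩ | ⟨cB, cP, cQ⟩ | ⟨cB, cC, cP, cQ⟩
  · -- c in the chain
    rcases cls a ha with ⟨ka, rfl⟩ | ⟨aB, aP, aQ⟩ | ⟨aB, aC, aP, aQ⟩ <;>
    rcases cls b hb with ⟨kb, rfl⟩ | ⟨bB, bP, bQ⟩ | ⟨bB, bC, bP, bQ⟩
    · by_cases hab : ka = kb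
      · subst hab
        exact hQ.self (fun h' => by rw [h'] at h; exact hP.irr h)
      · have : kc < ka ∧ kc < kb := by
          by_contra hcon
          rcases lt_trichotomy ka kb with h1 | h1 | h1
          · rcases lt_trichotomy ka kc with h2 | h2 | h2
            · exact hP.nt (hP.cc h1 h2) (hP.symm h)
            · subst h2; exact hP.irr h
            · exact hcon ⟨h2, h2.trans h1⟩
          · exact hab h1
          · rcases lt_trichotomy kb kc with h2 | h2 | h2
            · exact hP.nt (hP.cc h1 h2) h
            · subst h2; exact hP.irr' h
            · exact hcon ⟨h2.trans h1, h2⟩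
        exact hQ.cc this.1 this.2
    · rcases lt_trichotomy ka kc with h2 | h2 | h2
      · exact absurd (hP.symm h) (hP.nt (hP.d1 bP h2))
      · subst h2; exact absurd h hP.irr
      · exact hQ.symm (hQ.d1 bQ h2)
    · exact absurd h (hP.nt (hP.u bC bP _ _))
    · rcases lt_trichotomy kb kc with h2 | h2 | h2
      · exact absurd h (hP.nt (hP.d1 aP h2))
      · subst h2; exact absurd h hP.irr'
      · exact hQ.d1 aQ h2
    · exact hQ.d2 aQ bQ _
    · exact absurd h (hP.nt (hP.d3 hm aP bC bP _))
    · exact absurd (hP.symm h) (hP.nt (hP.u aC aP _ _))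
    · exact absurd (hP.symm h) (hP.nt (hP.d3 hm bP aC aP _))
    · exact hQ.sub2 _ aC aQ ((hPQ _ aB _ bB _ hi).mp (hP.sub2 _ aC aP h))
  · rcases cls a ha with ⟨ka, rfl⟩ | ⟨aB, aP, aQ⟩ | ⟨aB, aC, aP, aQ⟩ <;>
    rcases cls b hb with ⟨kb, rfl⟩ | ⟨bB, bP, bQ⟩ | ⟨bB, bC, bP, bQ⟩
    · rcases lt_trichotomy ka kb with h2 | h2 | h2
      · exact absurd (hP.symm h) (hP.nt (hP.symm (hP.d1 cP h2)))
      · subst h2; exact hQ.self (hQ.dC cQ ka).symm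
      · exact absurd h (hP.nt (hP.symm (hP.d1 cP h2)))
    · exact absurd (hP.symm h) (hP.nt (hP.d2 bP cP _))
    · exact absurd h (hP.nt (hP.symm (hP.d3 hm cP bC bP _)))
    · exact absurd h (hP.nt (hP.d2 aP cP _))
    · exact (hPQ _ aB _ bB _ cB).mp h
    · exact (hPQ _ aB _ bB _ cB).mp h
    · exact absurd (hP.symm h) (hP.nt (hP.symm (hP.d3 hm cP aC aP _)))
    · exact (hPQ _ aB _ bB _ cB).mp h
    · exact (hPQ _ aB _ bB _ cB).mp h
  · have key : ∀ b, b ∈ B ∨ (∃ k, b = x k) → ∀ k, P (x k) b c → Q (x k) b c := by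
      rintro b (hb | ⟨k', rfl⟩) k h
      · exact hQ.sub1 _ cC cQ ((hPQ _ hi _ hb _ cB).mp (hP.sub1 _ cC cP h))
      · exact hQ.u cC cQ _ _
    have hor : ∀ y ∈ B ∪ Set.range x, y ∈ B ∨ ∃ k, y = x k := by
      rintro y (h | ⟨k, h⟩)
      · exact Or.inl h
      · exact Or.inr ⟨k, h.symm⟩
    rcases hor a ha with h1 | ⟨k, rfl⟩
    · rcases hor b hb with h2 | ⟨k, rfl⟩
      · exact (hPQ _ h1 _ h2 _ cB).mp h
      · exact hQ.symm (key a (Or.inl h1) k (hP.symm h))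
    · exact key b (hor b hb) k h

theorem disj_union (h : ChainRel x R D) (hm : 2 ≤ m) {B B' : Set X} {i j : Fin m} (hij : i < j)
    (hi : x i ∈ B) (hj : x j ∈ B)
    (hd : ∀ a ∈ B, ∀ b ∈ B, ∀ c ∈ B', ∀ d ∈ B', R a b c ∨ R c d a) :
    ∀ a ∈ B ∪ Set.range x, ∀ b ∈ B ∪ Set.range x, ∀ c ∈ B' \ Set.range x,
      ∀ d ∈ B' \ Set.range x, R a b c ∨ R c d a := by
  have hor : ∀ y ∈ B ∪ Set.range x, y ∈ B ∨ ∃ k, y = x k := by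
    rintro y (h | ⟨k, h⟩)
    · exact Or.inl h
    · exact Or.inr ⟨k, h.symm⟩
  intro a ha b hb c hc d hd'
  have cC : ∀ i, c ≠ x i := fun i h => hc.2 ⟨i, h.symm⟩
  have dC : ∀ i, d ≠ x i := fun i h => hd'.2 ⟨i, h.symm⟩
  -- no block meets both sides
  have noX : ∀ c ∈ B', ∀ d ∈ B', D c → (∀ i, d ≠ x i) → ¬ D d → False := by
    intro c hc d hd' h1 h2 h3
    rcases hd _ hi _ hj c hc d hd' with h4 | h4
    · exact h.nt (h.symm (h.d1 h1 hij)) (h.symm h4)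
    · exact h.nt (h.d3 hm h1 h2 h3 i) h4
  by_cases cD : D c
  · by_cases dD : D d
    · rcases hor a ha with h1 | ⟨k, rfl⟩
      · by_cases aC : ∃ k, a = x k
        · obtain ⟨k, rfl⟩ := aC
          exact Or.inr (h.d2 cD dD _)
        · push Not at aC
          by_cases aD : D a
          · rcases hd a h1 _ hi c hc.1 d hd'.1 with h4 | h4
            · exact absurd h4 (h.nt (h.d2 aD cD _))
            · exact Or.inr h4
          · exact Or.inr (h.d4 hm cD dD aC aD)
      · exact Or.inr (h.d2 cD dD _)
    · exact (noX c hc.1 d hd'.1 cD dC dD).elim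
  · by_cases dD : D d
    · exact (noX d hd'.1 c hc.1 dD cC cD).elim
    · rcases hor a ha with h1 | ⟨k, rfl⟩
      · rcases hor b hb with h2 | ⟨k, rfl⟩
        · exact hd _ h1 _ h2 _ hc.1 _ hd'.1
        · rcases hd _ h1 _ hi _ hc.1 _ hd'.1 with h4 | h4
          · exact Or.inl (h.symm (h.sub1 _ cC cD (h.symm h4)))
          · exact Or.inr h4
      · rcases hor b hb with h2 | ⟨k, rfl⟩
        · rcases hd _ hi _ h2 _ hc.1 _ hd'.1 with h4 | h4
          · exact Or.inl (h.sub1 _ cC cD h4)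
          · exact Or.inr (h.sub2 _ cC cD h4)
        · exact Or.inl (h.u cC cD _ _)

/-- a nontrivial chain block and another block cannot cross the chain -/
theorem no_cross (h : ChainRel x R D) (hm : 2 ≤ m) {i : Fin m} {y c d : X} (hy : ∀ i, y ≠ x i)
    (cC : ∀ i, c ≠ x i) (cD : ¬ D c) (dD : D d) : ¬ (R d c (x i) ∨ R (x i) y d) := by
  rintro (h1 | h1)
  · exact h.nt (h.d3 hm dD cC cD i) h1
  · by_cases hyD : D y
    · exact h.nt (h.d2 hyD dD i) (h.symm h1)
    · exact h.nt (h.symm (h.d3 hm dD hy hyD i)) h1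

/-- two blocks cannot both cross -/
theorem no_cross2 (h : ChainRel x R D) (hm : 2 ≤ m) {c d c' d' : X}
    (cC : ∀ i, c ≠ x i) (cD : ¬ D c) (dD : D d) (cC' : ∀ i, c' ≠ x i) (cD' : ¬ D c') (dD' : D d') :
    ¬ (R d c d' ∨ R d' c' d) := by
  rintro (h1 | h1)
  · exact h.nt (h.d4 hm dD dD' cC cD) h1
  · exact h.nt (h.d4 hm dD' dD cC' cD') h1

/-- two nontrivial chain blocks -/
theorem two_blocks (h : ChainRel x R D) {i j : Fin m} (hij : i < j) {y z : X}
    (hy : ∀ i, y ≠ x i) (hz : ∀ i, z ≠ x i)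
    (h1 : R (x i) y (x j) ∨ R (x j) z (x i)) (h2 : R y (x i) z ∨ R z (x j) y) :
    ¬ D y ∧ D z := by
  have hyD : ¬ D y := by
    intro hyD
    have h3 : R (x j) z (x i) := by
      rcases h1 with h3 | h3
      · exact absurd (h.symm h3) (h.nt (h.d1 hyD hij))
      · exact h3
    have hzD := (h.D_iff hz hij).mpr (h.symm h3)
    rcases h2 with h4 | h4
    · exact h.nt (h.d2 hyD hzD i) h4
    · exact h.nt (h.d2 hzD hyD j) h4
  refine ⟨hyD, ?_⟩
  rcases h1 with h3 | h3
  · exact absurd h3 (h.nt (h.u hy hyD i j))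
  · exact (h.D_iff hz hij).mpr (h.symm h3)

end ChainRel
/-- Partial agreement forests on the taxa `Y`, expressed with triples. -/
structure PForest {X ι : Type*} (R : ι → X → X → X → Prop) (Y : Set X) (F : Set (Set X)) :
    Prop where
  ne : ∀ B ∈ F, B.Nonempty
  un : ∀ y, y ∈ Y ↔ ∃ B ∈ F, y ∈ B
  agree : ∀ B ∈ F, ∀ s t, ∀ a ∈ B, ∀ b ∈ B, ∀ c ∈ B, R s a b c → R t a b c
  disj : ∀ B ∈ F, ∀ B' ∈ F, B ≠ B' → ∀ s, ∀ a ∈ B, ∀ b ∈ B, ∀ c ∈ B', ∀ d ∈ B',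
    R s a b c ∨ R s c d a

section comb

variable {X : Type} {ι : Type*} {m : ℕ} {x : Fin m → X} {R : ι → X → X → X → Prop}
  {D : ι → X → Prop}

theorem not_range {y : X} (h : y ∉ Set.range x) : ∀ i, y ≠ x i := fun i h' => h ⟨i, h'.symm⟩

theorem PForest.remove {Y C : Set X} {F : Set (Set X)} (hF : PForest R Y F) :
    PForest R (Y \ C) {Z | Z.Nonempty ∧ ∃ B ∈ F, Z = B \ C} := by
  refine ⟨fun B hB => hB.1, ?_, ?_, ?_⟩
  · intro y
    constructor
    · rintro ⟨h1, h2⟩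
      obtain ⟨B, hB, hy⟩ := (hF.un y).mp h1
      exact ⟨B \ C, ⟨⟨y, hy, h2⟩, B, hB, rfl⟩, hy, h2⟩
    · rintro ⟨_, ⟨_, B, hB, rfl⟩, hy⟩
      exact ⟨(hF.un y).mpr ⟨B, hB, hy.1⟩, hy.2⟩
  · rintro _ ⟨_, B, hB, rfl⟩ s t a ha b hb c hc
    exact hF.agree B hB s t a ha.1 b hb.1 c hc.1
  · rintro _ ⟨_, B, hB, rfl⟩ _ ⟨_, B', hB', rfl⟩ hne s a ha b hb c hc d hd
    refine hF.disj B hB B' hB' ?_ s a ha.1 b hb.1 c hc.1 d hd.1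
    rintro rfl
    exact hne rfl

theorem PForest.case_two [Finite X] (h : ∀ s, ChainRel x (R s) (D s)) (hm : 2 ≤ m) {Y : Set X}
    {F : Set (Set X)} (hF : PForest R Y F) (hY : ∀ y, y ∉ Set.range x → y ∈ Y) {B : Set X}
    (hB : B ∈ F) {i j : Fin m} (hij : i < j) (hi : x i ∈ B) (hj : x j ∈ B) :
    ∃ F', PForest R Set.univ F' ∧ F'.ncard ≤ F.ncard := by
  set C := Set.range x with hC
  refine ⟨insert (B ∪ C) {Z | Z.Nonempty ∧ ∃ B' ∈ F, B' ≠ B ∧ Z = B' \ C}, ⟨?_, ?_, ?_, ?_⟩, ?_⟩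
  · rintro Z (rfl | hZ)
    · exact ⟨x i, Or.inl hi⟩
    · exact hZ.1
  · intro y
    refine ⟨fun _ => ?_, fun _ => Set.mem_univ _⟩
    by_cases hy : y ∈ B ∪ C
    · exact ⟨_, Or.inl rfl, hy⟩
    · have hyC : y ∉ C := fun h => hy (Or.inr h)
      obtain ⟨B', hB', hy'⟩ := (hF.un y).mp (hY y hyC)
      refine ⟨B' \ C, Or.inr ⟨⟨y, hy', hyC⟩, B', hB', ?_, rfl⟩, hy', hyC⟩
      rintro rfl
      exact hy (Or.inl hy')
  · rintro Z (rfl | ⟨_, B', hB', _, rfl⟩) s t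
    · exact ChainRel.agree_union (h s) (h t) hm hij hi hj
        (fun a ha b hb c hc => ⟨hF.agree B hB s t a ha b hb c hc, hF.agree B hB t s a ha b hb c hc⟩)
    · intro a ha b hb c hc
      exact hF.agree B' hB' s t a ha.1 b hb.1 c hc.1
  · rintro Z (rfl | ⟨_, B', hB', hne', rfl⟩) Z' (rfl | ⟨_, B'', hB'', hne'', rfl⟩) hne s
    · exact absurd rfl hne
    · exact (h s).disj_union hm hij hi hj (hF.disj B hB B'' hB'' hne''.symm s)
    · intro a ha b hb c hc d hd
      exact ((h s).disj_union hm hij hi hj (hF.disj B hB B' hB' hne'.symm s) c hc d hd a ha b hb).symm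
    · intro a ha b hb c hc d hd
      refine hF.disj B' hB' B'' hB'' ?_ s a ha.1 b hb.1 c hc.1 d hd.1
      rintro rfl
      exact hne rfl
  · have hsub : {Z | Z.Nonempty ∧ ∃ B' ∈ F, B' ≠ B ∧ Z = B' \ C} ⊆
        (fun B' => B' \ C) '' (F \ {B}) := by
      rintro _ ⟨_, B', hB', hne, rfl⟩
      exact ⟨B', ⟨hB', hne⟩, rfl⟩
    have h1 := Set.ncard_le_ncard hsub (Set.toFinite _)
    have h2 := Set.ncard_image_le (f := fun B' => B' \ C) (Set.toFinite (F \ {B}))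
    have h3 := Set.ncard_diff_singleton_add_one hB (Set.toFinite F)
    have h4 := Set.ncard_insert_le (B ∪ C) {Z | Z.Nonempty ∧ ∃ B' ∈ F, B' ≠ B ∧ Z = B' \ C}
    omega

/-- adding the full chain as a block -/
theorem PForest.add_chain (h : ∀ s, ChainRel x (R s) (D s)) (hm : 2 ≤ m) {G : Set (Set X)}
    (hG : PForest R (Set.range x)ᶜ G)
    (hnc : ∀ Z ∈ G, ∀ s, ∀ u ∈ Z, ∀ d ∈ Z, D s d → D s u) :
    PForest R Set.univ (insert (Set.range x) G) := by
  have hZC : ∀ Z ∈ G, ∀ y ∈ Z, ∀ i, y ≠ x i := fun Z hZ y hy =>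
    not_range ((hG.un y).mpr ⟨Z, hZ, hy⟩)
  have key : ∀ Z ∈ G, ∀ s, ∀ a ∈ Set.range x, ∀ b ∈ Set.range x, ∀ c ∈ Z, ∀ d ∈ Z,
      R s a b c ∨ R s c d a := by
    rintro Z hZ s _ ⟨i, rfl⟩ _ ⟨j, rfl⟩ c hc d hd
    by_cases hD : D s c
    · exact Or.inr ((h s).d2 hD (hnc Z hZ s d hd c hc hD) i)
    · exact Or.inl ((h s).u (hZC Z hZ c hc) hD i j)
  refine ⟨?_, ?_, ?_, ?_⟩
  · rintro Z (rfl | hZ)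
    · exact ⟨x ⟨0, by omega⟩, _, rfl⟩
    · exact hG.ne Z hZ
  · intro y
    refine ⟨fun _ => ?_, fun _ => Set.mem_univ _⟩
    by_cases hy : y ∈ Set.range x
    · exact ⟨_, Or.inl rfl, hy⟩
    · obtain ⟨B, hB, hyB⟩ := (hG.un y).mp hy
      exact ⟨B, Or.inr hB, hyB⟩
  · rintro Z (rfl | hZ) s t
    · have h01 : (⟨0, by omega⟩ : Fin m) < ⟨1, by omega⟩ := by simp
      have h1 : x ⟨0, by omega⟩ ∈ Set.range x := ⟨_, rfl⟩
      have h2 : x ⟨1, by omega⟩ ∈ Set.range x := ⟨_, rfl⟩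
      intro a ha b hb c hc hs
      obtain ⟨i, rfl⟩ := ha
      obtain ⟨j, rfl⟩ := hb
      obtain ⟨k, rfl⟩ := hc
      have := ChainRel.agree_union (B := {x ⟨0, by omega⟩, x ⟨1, by omega⟩}) (h s) (h t) hm h01
        (by simp) (by simp) ?_ (x i) (Or.inr ⟨_, rfl⟩) (x j) (Or.inr ⟨_, rfl⟩) (x k)
        (Or.inr ⟨_, rfl⟩) hs
      · exact this
      · have hne : x ⟨0, by omega⟩ ≠ x ⟨1, by omega⟩ := fun h' => by
          have := (h s).inj h'
          simp at this
        have a1 := fun s => (h s).self hne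
        have a2 := fun s => (h s).self hne.symm
        have a3 := fun s a b => @ChainRel.irr _ _ _ _ _ (h s) a b
        have a4 := fun s a b => @ChainRel.irr' _ _ _ _ _ (h s) a b
        rintro a (rfl | rfl) b (rfl | rfl) c (rfl | rfl) <;>
          simp only [a1, a2, a3, a4]
    · exact hG.agree Z hZ s t
  · rintro Z (rfl | hZ) Z' (rfl | hZ') hne s
    · exact absurd rfl hne
    · exact key Z' hZ' s
    · intro a ha b hb c hc d hd
      exact (key Z hZ s c hc d hd a ha b hb).symm
    · exact hG.disj Z hZ Z' hZ' hne s

/-- splitting one block along the chain of tree `s₀` -/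
theorem PForest.split_block [Finite X] (h : ∀ s, ChainRel x (R s) (D s)) (hm : 2 ≤ m)
    {G : Set (Set X)}
    (hG : PForest R (Set.range x)ᶜ G) {Z : Set X} (hZ : Z ∈ G) (s₀ : ι) {u d : X} (hu : u ∈ Z)
    (hd : d ∈ Z) (hud : ¬ D s₀ u) (hdd : D s₀ d) :
    PForest R (Set.range x)ᶜ
      (insert {y | y ∈ Z ∧ D s₀ y} (insert {y | y ∈ Z ∧ ¬ D s₀ y} (G \ {Z}))) ∧
    (insert {y | y ∈ Z ∧ D s₀ y} (insert {y | y ∈ Z ∧ ¬ D s₀ y} (G \ {Z}))).ncard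
      ≤ G.ncard + 1 := by
  have hZC : ∀ Z ∈ G, ∀ y ∈ Z, ∀ i, y ≠ x i := fun Z hZ y hy =>
    not_range ((hG.un y).mpr ⟨Z, hZ, hy⟩)
  have key : ∀ s, ∀ a, a ∈ Z ∧ D s₀ a → ∀ b, b ∈ Z ∧ D s₀ b → ∀ c, c ∈ Z ∧ ¬ D s₀ c →
      R s a b c := by
    intro s a ha b hb c hc
    exact hG.agree Z hZ s₀ s a ha.1 b hb.1 c hc.1
      ((h s₀).d4 hm ha.2 hb.2 (hZC Z hZ c hc.1) hc.2)
  have own : ∀ W ∈ insert {y | y ∈ Z ∧ D s₀ y} (insert {y | y ∈ Z ∧ ¬ D s₀ y} (G \ {Z})),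
      ∃ V ∈ G, W ⊆ V ∧ (V ≠ Z → W = V) := by
    rintro W (rfl | rfl | hW)
    · exact ⟨Z, hZ, fun y hy => hy.1, fun h => absurd rfl h⟩
    · exact ⟨Z, hZ, fun y hy => hy.1, fun h => absurd rfl h⟩
    · exact ⟨W, hW.1, subset_rfl, fun _ => rfl⟩
  refine ⟨⟨?_, ?_, ?_, ?_⟩, ?_⟩
  · rintro W (rfl | rfl | hW)
    · exact ⟨d, hd, hdd⟩
    · exact ⟨u, hu, hud⟩
    · exact hG.ne W hW.1
  · intro y
    rw [hG.un y]
    constructor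
    · rintro ⟨B, hB, hy⟩
      by_cases hBZ : B = Z
      · subst hBZ
        by_cases hD : D s₀ y
        · exact ⟨_, Or.inl rfl, hy, hD⟩
        · exact ⟨_, Or.inr (Or.inl rfl), hy, hD⟩
      · exact ⟨B, Or.inr (Or.inr ⟨hB, hBZ⟩), hy⟩
    · rintro ⟨W, hW, hy⟩
      obtain ⟨V, hV, hWV, _⟩ := own W hW
      exact ⟨V, hV, hWV hy⟩
  · intro W hW s t a ha b hb c hc
    obtain ⟨V, hV, hWV, _⟩ := own W hW
    exact hG.agree V hV s t a (hWV ha) b (hWV hb) c (hWV hc)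
  · intro W hW W' hW' hne s a ha b hb c hc d hd
    have gen : ∀ V ∈ G, ∀ V' ∈ G, V ≠ V' → W ⊆ V → W' ⊆ V' → R s a b c ∨ R s c d a :=
      fun V hV V' hV' hVV h1 h2 =>
        hG.disj V hV V' hV' hVV s a (h1 ha) b (h1 hb) c (h2 hc) d (h2 hd)
    have sD : {y | y ∈ Z ∧ D s₀ y} ⊆ Z := fun y hy => hy.1
    have sU : {y | y ∈ Z ∧ ¬ D s₀ y} ⊆ Z := fun y hy => hy.1
    rcases hW with rfl | rfl | hW <;> rcases hW' with rfl | rfl | hW'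
    · exact absurd rfl hne
    · exact Or.inl (key s a ha b hb c hc)
    · exact gen Z hZ W' hW'.1 (Ne.symm hW'.2) sD subset_rfl
    · exact Or.inr (key s c hc d hd a ha)
    · exact absurd rfl hne
    · exact gen Z hZ W' hW'.1 (Ne.symm hW'.2) sU subset_rfl
    · exact gen W hW.1 Z hZ hW.2 subset_rfl sD
    · exact gen W hW.1 Z hZ hW.2 subset_rfl sU
    · exact gen W hW.1 W' hW'.1 hne subset_rfl subset_rfl
  · have h3 := Set.ncard_diff_singleton_add_one hZ (Set.toFinite G)
    have h4 := Set.ncard_insert_le {y | y ∈ Z ∧ D s₀ y} (insert {y | y ∈ Z ∧ ¬ D s₀ y} (G \ {Z}))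
    have h5 := Set.ncard_insert_le {y | y ∈ Z ∧ ¬ D s₀ y} (G \ {Z})
    omega

theorem PForest.refine [Finite X] (h : ∀ s, ChainRel x (R s) (D s)) (hm : 2 ≤ m)
    {G : Set (Set X)} (hG : PForest R (Set.range x)ᶜ G) (S : Finset ι) :
    ∃ G', PForest R (Set.range x)ᶜ G' ∧ G'.ncard ≤ G.ncard + S.card ∧
      ∀ s ∈ S, ∀ Z ∈ G', ∀ u ∈ Z, ∀ d ∈ Z, D s d → D s u := by
  classical
  induction S using Finset.induction_on with
  | empty => exact ⟨G, hG, by simp, by simp⟩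
  | insert s S hs ih =>
    obtain ⟨G', hG', hcard, hnc⟩ := ih
    rw [Finset.card_insert_of_notMem hs]
    by_cases hall : ∀ Z ∈ G', ∀ u ∈ Z, ∀ d ∈ Z, D s d → D s u
    · refine ⟨G', hG', by omega, fun t ht => ?_⟩
      rcases Finset.mem_insert.mp ht with rfl | ht
      · exact hall
      · exact hnc t ht
    · push Not at hall
      obtain ⟨Z, hZ, u, hu, d, hd, hdd, hud⟩ := hall
      have hZC : ∀ Z ∈ G', ∀ y ∈ Z, ∀ i, y ≠ x i := fun Z hZ y hy =>
        not_range ((hG'.un y).mpr ⟨Z, hZ, hy⟩)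
      obtain ⟨h1, h2⟩ := hG'.split_block h hm hZ s hu hd hud hdd
      refine ⟨_, h1, by omega, fun t ht => ?_⟩
      rcases Finset.mem_insert.mp ht with rfl | ht
      · rintro W (rfl | rfl | hW) u' hu' d' hd' hD
        · exact hu'.2
        · exact absurd hD hd'.2
        · by_contra hcon
          exact (h t).no_cross2 hm (hZC Z hZ u hu) hud hdd (hZC W hW.1 u' hu') hcon hD
            (hG'.disj Z hZ W hW.1 (Ne.symm hW.2) t d hd u hu d' hd' u' hu')
      · rintro W (rfl | rfl | hW) u' hu' d' hd' hD
        · exact hnc t ht Z hZ u' hu'.1 d' hd'.1 hD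
        · exact hnc t ht Z hZ u' hu'.1 d' hd'.1 hD
        · exact hnc t ht W hW.1 u' hu' d' hd' hD

/-- the part of a chain block below the chain does not depend on the tree -/
theorem cross_eq (h : ∀ s, ChainRel x (R s) (D s)) (hm : 2 ≤ m) {B : Set X} {i : Fin m}
    (hi : x i ∈ B) (hB : ∀ s t, ∀ a ∈ B, ∀ b ∈ B, ∀ c ∈ B, R s a b c → R t a b c) {s t : ι}
    {d d0 : X} (hd : d ∈ B) (hd0 : d0 ∈ B) (hdC : ∀ i, d ≠ x i) (hd0C : ∀ i, d0 ≠ x i)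
    (h1 : D s d) (h2 : D t d0) : D t d := by
  by_contra h3
  have h4 := hB t s d0 hd0 _ hi d hd ((h t).d3 hm h2 hdC h3 i)
  by_cases h5 : D s d0
  · exact (h s).nt h4 ((h s).d2 h5 h1 i)
  · exact (h s).nt ((h s).symm h4) ((h s).symm ((h s).d3 hm h1 hd0C h5 i))

end comb

section comb2

variable {X : Type} {ι : Type*} {m : ℕ} {x : Fin m → X} {R : ι → X → X → X → Prop}
  {D : ι → X → Prop}

theorem PForest.uniq [Nonempty ι] (h : ∀ s, ChainRel x (R s) (D s)) {Y : Set X} {F : Set (Set X)}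
    (hF : PForest R Y F) {B B' : Set X} (hB : B ∈ F) (hB' : B' ∈ F) {y : X} (hy : y ∈ B)
    (hy' : y ∈ B') : B = B' := by
  by_contra hne
  obtain ⟨s⟩ := ‹Nonempty ι›
  rcases hF.disj B hB B' hB' hne s y hy y hy y hy' y hy' with h1 | h1
  · exact (h s).irr h1
  · exact (h s).irr h1

theorem three_aux {a b c : Prop} {i j k : Fin m} (e1 : i ≠ j) (e2 : k ≠ i) (e3 : k ≠ j)
    (p1 : i < j → ¬ a ∧ b) (p2 : j < i → ¬ b ∧ a) (p3 : i < k → ¬ a ∧ c) (p4 : k < i → ¬ c ∧ a)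
    (p5 : j < k → ¬ b ∧ c) (p6 : k < j → ¬ c ∧ b) : False := by
  rcases lt_or_gt_of_ne e1 with q1 | q1 <;> rcases lt_or_gt_of_ne e2 with q2 | q2 <;>
    rcases lt_or_gt_of_ne e3 with q3 | q3 <;> first | tauto | omega

theorem PForest.main [Finite X] [Fintype ι] [Nonempty ι] (h : ∀ s, ChainRel x (R s) (D s))
    {kr r : ℕ} (hk : 1 ≤ kr) (hr : r = min (max kr 3) (Fintype.card ι + 1)) (hr3 : 3 ≤ r)
    (hrm : r < m) {Y : Set X} (hY : ∀ y, y ∈ Y ↔ ∀ k : Fin m, r ≤ (k : ℕ) → x k ≠ y)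
    {F : Set (Set X)} (hF : PForest R Y F) (hFk : F.ncard ≤ kr) :
    ∃ F', PForest R Set.univ F' ∧ F'.ncard ≤ kr := by
  have hm : 2 ≤ m := by omega
  have hYC : ∀ y, y ∉ Set.range x → y ∈ Y := fun y hy =>
    (hY y).mpr fun k _ hk => hy ⟨k, hk⟩
  by_cases htwo : ∃ B ∈ F, ∃ i j, i < j ∧ x i ∈ B ∧ x j ∈ B
  · obtain ⟨B, hB, i, j, hij, hi, hj⟩ := htwo
    obtain ⟨F', h1, h2⟩ := hF.case_two h hm hYC hB hij hi hj
    exact ⟨F', h1, h2.trans hFk⟩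
  have hone : ∀ B ∈ F, ∀ i j, x i ∈ B → x j ∈ B → i = j := by
    intro B hB i j hi hj
    by_contra hne
    rcases lt_or_gt_of_ne hne with h1 | h1
    · exact htwo ⟨B, hB, i, j, h1, hi, hj⟩
    · exact htwo ⟨B, hB, j, i, h1, hj, hi⟩
  clear htwo
  set C := Set.range x with hC
  set K : Set (Set X) := {B | B ∈ F ∧ ∃ i, x i ∈ B} with hK
  set N : Set (Set X) := {B | B ∈ F ∧ ∀ i, x i ∉ B} with hN
  set P : Set (Set X) := {B | B ∈ K ∧ (B \ C).Nonempty} with hP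
  have hYx : ∀ k : Fin r, x ⟨k, by omega⟩ ∈ Y := by
    intro k
    rw [hY]
    intro l hl hlk
    obtain ⟨s⟩ := ‹Nonempty ι›
    have := (h s).inj hlk
    rw [this] at hl
    have := k.2
    simp at hl
    omega
  have hKr : r ≤ K.ncard := by
    choose β hβ1 hβ2 using fun k : Fin r => (hF.un _).mp (hYx k)
    have hinj : Function.Injective β := by
      intro k l hkl
      have := hone (β k) (hβ1 k) _ _ (hβ2 k) (hkl ▸ hβ2 l)
      exact Fin.ext (by simpa using this)
    have h1 : Set.range β ⊆ K := by
      rintro _ ⟨k, rfl⟩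
      exact ⟨hβ1 k, _, hβ2 k⟩
    have h2 := Set.ncard_le_ncard h1 (Set.toFinite _)
    rw [← Set.image_univ, Set.ncard_image_of_injective _ hinj, Set.ncard_univ] at h2
    simpa using h2
  have hNF : N.ncard + K.ncard ≤ F.ncard := by
    rw [← Set.ncard_union_eq ?_ (Set.toFinite _) (Set.toFinite _)]
    · apply Set.ncard_le_ncard ?_ (Set.toFinite _)
      rintro B (hB | hB)
      · exact hB.1
      · exact hB.1
    · rw [Set.disjoint_left]
      rintro B hB ⟨_, i, hi⟩
      exact hB.2 i hi
  have hG := hF.remove (C := C)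
  set G : Set (Set X) := {Z | Z.Nonempty ∧ ∃ B ∈ F, Z = B \ C} with hGdef
  have hYeq : Y \ C = Cᶜ := by
    ext y
    exact ⟨fun hy => hy.2, fun hy => ⟨hYC y hy, hy⟩⟩
  rw [hYeq] at hG
  have hGcl : ∀ Z ∈ G, Z ∈ N ∨ ∃ B ∈ P, Z = B \ C := by
    rintro Z ⟨hne, B, hB, rfl⟩
    by_cases hi : ∃ i, x i ∈ B
    · exact Or.inr ⟨B, ⟨⟨hB, hi⟩, hne⟩, rfl⟩
    · left
      push Not at hi
      have : B \ C = B := by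
        ext y
        refine ⟨fun hy => hy.1, fun hy => ⟨hy, ?_⟩⟩
        rintro ⟨i, rfl⟩
        exact hi i hy
      rw [this]
      exact ⟨hB, hi⟩
  have hGcard : G.ncard ≤ N.ncard + P.ncard := by
    have h1 : G ⊆ N ∪ (fun B => B \ C) '' P := by
      intro Z hZ
      rcases hGcl Z hZ with h2 | ⟨B, hB, rfl⟩
      · exact Or.inl h2
      · exact Or.inr ⟨B, hB, rfl⟩
    have h2 := Set.ncard_le_ncard h1 (Set.toFinite _)
    have h3 := Set.ncard_union_le N ((fun B => B \ C) '' P)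
    have h4 := Set.ncard_image_le (f := fun B => B \ C) (Set.toFinite P)
    omega
  have hZC : ∀ Z ∈ G, ∀ y ∈ Z, ∀ i, y ≠ x i := fun Z hZ y hy =>
    not_range ((hG.un y).mpr ⟨Z, hZ, hy⟩)
  have fin : ∀ G', PForest R Cᶜ G' → G'.ncard + 1 ≤ kr →
      (∀ Z ∈ G', ∀ s, ∀ u ∈ Z, ∀ d ∈ Z, D s d → D s u) →
      ∃ F', PForest R Set.univ F' ∧ F'.ncard ≤ kr := by
    intro G' hG' hc hnc
    refine ⟨_, PForest.add_chain h hm hG' hnc, ?_⟩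
    have := Set.ncard_insert_le (Set.range x) G'
    omega
  by_cases hPe : P = ∅
  · have hP0 : P.ncard = 0 := by rw [hPe]; simp
    by_cases hcase : r = Fintype.card ι + 1
    · obtain ⟨G', h1, h2, h3⟩ := hG.refine h hm Finset.univ
      refine fin G' h1 ?_ fun Z hZ s => h3 s (Finset.mem_univ s) Z hZ
      rw [Finset.card_univ] at h2
      omega
    · have hN0 : G.ncard = 0 := by omega
      have hG0 : G = ∅ := by rwa [Set.ncard_eq_zero (Set.toFinite _)] at hN0
      refine fin G hG (by omega) ?_
      rw [hG0]
      simp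
  obtain ⟨B, hBP⟩ := Set.nonempty_iff_ne_empty.mpr hPe
  obtain ⟨⟨hB, i, hi⟩, y, hy, hyC⟩ := id hBP
  have hncN : ∀ Z ∈ N, ∀ s, ∀ u ∈ Z, ∀ d ∈ Z, D s d → D s u := by
    intro Z hZ s u hu d hd hdD
    by_contra huD
    have hne : Z ≠ B := by
      rintro rfl
      exact hZ.2 i hi
    refine (h s).no_cross (i := i) hm (not_range hyC) ?_ huD hdD
      (hF.disj Z hZ.1 B hB hne s d hd u hu _ hi y hy)
    rintro j rfl
    exact hZ.2 j hu
  have hpair : ∀ B ∈ P, ∀ B' ∈ P, ∀ i j, x i ∈ B → x j ∈ B' → i < j → ∀ s, ∀ y ∈ B \ C,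
      ∀ z ∈ B' \ C, ¬ D s y ∧ D s z := by
    intro B hB B' hB' i j hi hj hij s y hy z hz
    have hne : B ≠ B' := by
      rintro rfl
      exact hij.ne (hone B hB.1.1 i j hi hj)
    have hd := hF.disj B hB.1.1 B' hB'.1.1 hne s
    exact (h s).two_blocks hij (not_range hy.2) (not_range hz.2)
      (hd _ hi _ hy.1 _ hj _ hz.1) (hd _ hy.1 _ hi _ hz.1 _ hj)
  have hidx : ∀ B ∈ P, ∀ B' ∈ P, B ≠ B' → ∀ i j, x i ∈ B → x j ∈ B' → i ≠ j := by
    rintro B hB B' hB' hne i j hi hj rfl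
    exact hne (hF.uniq h hB.1.1 hB'.1.1 hi hj)
  by_cases hP2 : ∃ B' ∈ P, B' ≠ B
  · obtain ⟨B', hB'P, hne⟩ := hP2
    obtain ⟨⟨hB', j, hj⟩, z, hz⟩ := id hB'P
    have hsub : P ⊆ {B, B'} := by
      intro B'' hB''P
      by_contra hcon
      simp only [Set.mem_insert_iff, Set.mem_singleton_iff, not_or] at hcon
      obtain ⟨⟨hB'', k, hk⟩, w, hw⟩ := id hB''P
      obtain ⟨s⟩ := ‹Nonempty ι›
      have e1 := hidx B hBP B' hB'P hne.symm i j hi hj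
      have e2 := hidx B'' hB''P B hBP hcon.1 k i hk hi
      have e3 := hidx B'' hB''P B' hB'P hcon.2 k j hk hj
      have p1 := fun hij => hpair B hBP B' hB'P i j hi hj hij s y ⟨hy, hyC⟩ z hz
      have p2 := fun hij => hpair B' hB'P B hBP j i hj hi hij s z hz y ⟨hy, hyC⟩
      have p3 := fun hij => hpair B hBP B'' hB''P i k hi hk hij s y ⟨hy, hyC⟩ w hw
      have p4 := fun hij => hpair B'' hB''P B hBP k i hk hi hij s w hw y ⟨hy, hyC⟩
      have p5 := fun hij => hpair B' hB'P B'' hB''P j k hj hk hij s z hz w hw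
      have p6 := fun hij => hpair B'' hB''P B' hB'P k j hk hj hij s w hw z hz
      exact three_aux e1 e2 e3 p1 p2 p3 p4 p5 p6
    have hPc : P.ncard ≤ 2 := by
      have h1 := Set.ncard_le_ncard hsub (Set.toFinite _)
      have h2 := Set.ncard_insert_le B {B'}
      rw [Set.ncard_singleton] at h2
      omega
    have other : ∀ A ∈ P, ∃ A' ∈ P, A' ≠ A := by
      intro A hA
      by_cases hAB : A = B
      · exact ⟨B', hB'P, hAB ▸ hne⟩
      · exact ⟨B, hBP, fun h => hAB h.symm⟩
    refine fin G hG (by omega) ?_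
    intro Z hZ s u hu d hd hdD
    rcases hGcl Z hZ with h2 | ⟨A, hA, rfl⟩
    · exact hncN Z h2 s u hu d hd hdD
    · obtain ⟨A', hA', hAne⟩ := other A hA
      obtain ⟨⟨_, k, hk⟩, _⟩ := id hA
      obtain ⟨⟨_, l, hl⟩, w, hw⟩ := id hA'
      rcases lt_or_gt_of_ne (hidx A hA A' hA' hAne.symm k l hk hl) with q | q
      · exact absurd hdD (hpair A hA A' hA' k l hk hl q s d hd w hw).1
      · exact (hpair A' hA' A hA l k hl hk q s w hw u hu).2
  · push Not at hP2
    have hPc : P.ncard ≤ 1 := by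
      have h1 : P ⊆ {B} := hP2
      simpa using Set.ncard_le_ncard h1 (Set.toFinite _)
    by_cases hall : ∀ Z ∈ G, ∀ s, ∀ u ∈ Z, ∀ d ∈ Z, D s d → D s u
    · exact fin G hG (by omega) hall
    · push Not at hall
      obtain ⟨Z, hZ, s₀, u, hu, d, hd, hdD, huD⟩ := hall
      have hZB : Z = B \ C := by
        rcases hGcl Z hZ with h2 | ⟨A, hA, hAZ⟩
        · exact absurd (hncN Z h2 s₀ u hu d hd hdD) huD
        · rw [hAZ, hP2 A hA]
      obtain ⟨h1, h2⟩ := hG.split_block h hm hZ s₀ hu hd huD hdD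
      refine fin _ h1 (by omega) ?_
      rintro W (rfl | rfl | hW) s u' hu' d' hd' hD
      · subst hZB
        exact cross_eq h hm hi (hF.agree B hB) hu'.1.1 hd'.1.1 (hZC _ hZ _ hu'.1)
          (hZC _ hZ _ hd'.1) hu'.2 hD
      · subst hZB
        exact absurd (cross_eq h hm hi (hF.agree B hB) hd'.1.1 hd.1 (hZC _ hZ _ hd'.1)
          (hZC _ hZ _ hd) hD hdD) hd'.2
      · rcases hGcl W hW.1 with h3 | ⟨A, hA, hAZ⟩
        · exact hncN W h3 s u' hu' d' hd' hD
        · refine absurd ?_ hW.2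
          rw [hAZ, hP2 A hA, hZB]
          rfl

end comb2

section bridge

variable {X : Type}

theorem pforest_of_forest {𝒯 : Set (RTree X)} {F : Set (Set X)}
    (hF : RTree.IsAgreementForest 𝒯 F) :
    PForest (fun s : 𝒯 => s.1.rt) Set.univ F := by
  obtain ⟨⟨h1, h2⟩, h3, h4⟩ := hF
  refine ⟨h1, ?_, ?_, ?_⟩
  · intro y
    obtain ⟨B, hB, _⟩ := h2 y
    exact ⟨fun _ => ⟨B, hB⟩, fun _ => Set.mem_univ _⟩
  · intro B hB s t a ha b hb c hc
    exact (RTree.restEq_iff.mp (h3 B hB s.1 s.2 t.1 t.2) a ha b hb c hc).mp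
  · intro B hB B' hB' hne s
    exact (s.1.disjoint_iff B B').mp (h4 B hB B' hB' hne s.1 s.2)

theorem forest_of_pforest {𝒯 : Set (RTree X)} (hne : 𝒯.Nonempty) {F : Set (Set X)}
    (hF : PForest (fun s : 𝒯 => s.1.rt) Set.univ F) :
    RTree.IsAgreementForest 𝒯 F := by
  refine ⟨⟨hF.ne, ?_⟩, ?_, ?_⟩
  · intro y
    obtain ⟨B, hB, hy⟩ := (hF.un y).mp (Set.mem_univ y)
    refine ⟨B, ⟨hB, hy⟩, ?_⟩
    rintro B' ⟨hB', hy'⟩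
    by_contra hn
    obtain ⟨T, hT⟩ := hne
    rcases hF.disj B' hB' B hB hn ⟨T, hT⟩ y hy' y hy' y hy y hy with h | h
    · exact T.rt_self.mp h rfl
    · exact T.rt_self.mp h rfl
  · intro B hB T hT T' hT'
    rw [RTree.restEq_iff]
    intro a ha b hb c hc
    exact ⟨hF.agree B hB ⟨T, hT⟩ ⟨T', hT'⟩ a ha b hb c hc,
      hF.agree B hB ⟨T', hT'⟩ ⟨T, hT⟩ a ha b hb c hc⟩
  · intro B hB B' hB' hn T hT
    exact (T.disjoint_iff B B').mpr (hF.disj B hB B' hB' hn ⟨T, hT⟩)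

theorem pforest_up {𝒯 : Set (RTree X)} {XC : Set X} {𝒯C : Set (RTree ↥XC)}
    (hres : RTree.IsRestrictionFamily 𝒯 XC 𝒯C) {F : Set (Set ↥XC)}
    (hF : PForest (fun s : 𝒯C => s.1.rt) Set.univ F) :
    PForest (fun s : 𝒯 => s.1.rt) XC ((fun Z : Set ↥XC => Subtype.val '' Z) '' F) := by
  choose f hf1 hf2 using hres.2
  refine ⟨?_, ?_, ?_, ?_⟩
  · rintro _ ⟨B, hB, rfl⟩
    exact (hF.ne B hB).image _
  · intro y
    constructor
    · intro hy
      obtain ⟨B, hB, hyB⟩ := (hF.un ⟨y, hy⟩).mp (Set.mem_univ _)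
      exact ⟨_, ⟨B, hB, rfl⟩, _, hyB, rfl⟩
    · rintro ⟨_, ⟨B, hB, rfl⟩, z, _, rfl⟩
      exact z.2
  · rintro _ ⟨B, hB, rfl⟩ s t _ ⟨a, ha, rfl⟩ _ ⟨b, hb, rfl⟩ _ ⟨c, hc, rfl⟩ h
    exact (RTree.rt_restriction (hf2 t.1 t.2) a b c).mp
      (hF.agree B hB ⟨_, hf1 s.1 s.2⟩ ⟨_, hf1 t.1 t.2⟩ a ha b hb c hc
        ((RTree.rt_restriction (hf2 s.1 s.2) a b c).mpr h))
  · rintro _ ⟨B, hB, rfl⟩ _ ⟨B', hB', rfl⟩ hne s _ ⟨a, ha, rfl⟩ _ ⟨b, hb, rfl⟩ _ ⟨c, hc, rfl⟩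
      _ ⟨d, hd, rfl⟩
    have hn : B ≠ B' := by
      rintro rfl
      exact hne rfl
    rcases hF.disj B hB B' hB' hn ⟨_, hf1 s.1 s.2⟩ a ha b hb c hc d hd with h | h
    · exact Or.inl ((RTree.rt_restriction (hf2 s.1 s.2) a b c).mp h)
    · exact Or.inr ((RTree.rt_restriction (hf2 s.1 s.2) c d a).mp h)

theorem pforest_down {𝒯 : Set (RTree X)} {XC : Set X} {𝒯C : Set (RTree ↥XC)}
    (hres : RTree.IsRestrictionFamily 𝒯 XC 𝒯C) {F : Set (Set X)}
    (hF : PForest (fun s : 𝒯 => s.1.rt) Set.univ F) :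
    PForest (fun s : 𝒯C => s.1.rt) Set.univ
      {Z : Set ↥XC | Z.Nonempty ∧ ∃ B ∈ F, Z = Subtype.val ⁻¹' B} := by
  choose f hf1 hf2 using hres.1
  refine ⟨fun B hB => hB.1, ?_, ?_, ?_⟩
  · intro y
    refine ⟨fun _ => ?_, fun _ => Set.mem_univ _⟩
    obtain ⟨B, hB, hyB⟩ := (hF.un y.1).mp (Set.mem_univ _)
    exact ⟨_, ⟨⟨y, hyB⟩, B, hB, rfl⟩, hyB⟩
  · rintro _ ⟨_, B, hB, rfl⟩ s t a ha b hb c hc h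
    exact (RTree.rt_restriction (hf2 t.1 t.2) a b c).mpr
      (hF.agree B hB ⟨_, hf1 s.1 s.2⟩ ⟨_, hf1 t.1 t.2⟩ a ha b hb c hc
        ((RTree.rt_restriction (hf2 s.1 s.2) a b c).mp h))
  · rintro _ ⟨_, B, hB, rfl⟩ _ ⟨_, B', hB', rfl⟩ hne s a ha b hb c hc d hd
    have hn : B ≠ B' := by
      rintro rfl
      exact hne rfl
    rcases hF.disj B hB B' hB' hn ⟨_, hf1 s.1 s.2⟩ a ha b hb c hc d hd with h | h
    · exact Or.inl ((RTree.rt_restriction (hf2 s.1 s.2) a b c).mpr h)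
    · exact Or.inr ((RTree.rt_restriction (hf2 s.1 s.2) c d a).mpr h)

theorem chainRel_of_chain {m : ℕ} (x : Fin m → X) (T : RTree X) (hm : 3 ≤ m)
    (hinj : Function.Injective x) (hc : T.IsChainIn x) : ∃ D, ChainRel x T.rt D := by
  obtain ⟨D, h1, h2, h3, h4, h5⟩ := T.chain_facts x hm hinj hc
  refine ⟨D, ?_⟩
  exact
    { symm := T.rt_symm
      self := fun h => T.rt_self.mpr h
      irr := by
        rintro a b ⟨v, g1, _, g3⟩
        exact g3 g1
      trans := T.rt_trans
      split := fun d h => T.rt_split d h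
      nt := T.rt_not
      inj := hinj
      dC := fun hy => not_range (h1 _ hy)
      cc := fun {i j k} hij hik => h2 i j k hij hik
      u := fun {y} hy hD => h3 y (fun ⟨i, hi⟩ => hy i hi.symm) hD
      d1 := fun {y} hy {i j} hij => h4 y hy i j hij
      d2 := fun {y y'} hy hy' => h5 y y' hy hy' }

end bridge

/-- **Lemma 7 (safeness of the chain reduction, rooted).** Let `𝒯` be a set of `t ≥ 2`
rooted binary phylogenetic trees on `X`, `k_r ≥ 1`, `r = min(max(k_r,3), t+1)`, and let
`x` be a common `m`-chain of `𝒯` with `m > r`. Let `𝒯_C` be the result of the chain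
reduction rule, i.e. the restriction of every tree to `X_C = X ∖ {x_{r+1}, …, x_m}`.
Then `𝒯_C` has a rooted agreement forest of size at most `k_r` iff `𝒯` has one of size
at most `k_r`. -/
theorem chain_reduction_safe_rooted (X : Type) [Finite X] (𝒯 : Set (RTree X))
    (t kr : ℕ) (ht : 𝒯.ncard = t) (ht2 : 2 ≤ t) (hk : 1 ≤ kr)
    (r : ℕ) (hr : r = min (max kr 3) (t + 1))
    (m : ℕ) (x : Fin m → X) (hm : r < m) (hx : RTree.IsCommonChain 𝒯 x)
    (XC : Set X) (hXC : XC = {a : X | ¬ ∃ i : Fin m, r ≤ (i : ℕ) ∧ x i = a})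
    (𝒯C : Set (RTree ↥XC)) (hres : RTree.IsRestrictionFamily 𝒯 XC 𝒯C) :
    (∃ F, RTree.IsAgreementForest 𝒯C F ∧ F.ncard ≤ kr) ↔
    (∃ F, RTree.IsAgreementForest 𝒯 F ∧ F.ncard ≤ kr) := by
  obtain ⟨_, hinj, hch⟩ := hx
  have hfin : 𝒯.Finite := Set.finite_of_ncard_ne_zero (by omega)
  have hne : 𝒯.Nonempty := Set.nonempty_of_ncard_ne_zero (by omega)
  have hneC : 𝒯C.Nonempty := by
    obtain ⟨T, hT⟩ := hne
    obtain ⟨T', hT', _⟩ := hres.2 T hT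
    exact ⟨T', hT'⟩
  constructor
  · rintro ⟨F, hF, hFk⟩
    have h1 := pforest_up hres (pforest_of_forest hF)
    have h2 := Set.ncard_image_le (f := fun Z : Set ↥XC => Subtype.val '' Z) (Set.toFinite F)
    have : Nonempty 𝒯 := hne.to_subtype
    have : Fintype 𝒯 := hfin.fintype
    have hcard : Fintype.card 𝒯 = t := by
      rw [← ht, ← Nat.card_coe_set_eq, Nat.card_eq_fintype_card]
    choose D hD using fun s : 𝒯 =>
      chainRel_of_chain x s.1 (by omega) hinj (hch s.1 s.2)
    obtain ⟨F', h3, h4⟩ := PForest.main (kr := kr) (r := r) hD hk (by rw [hcard]; exact hr)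
      (by omega) hm (by intro y; rw [hXC]; simp) h1 (h2.trans hFk)
    exact ⟨F', forest_of_pforest hne h3, h4⟩
  · rintro ⟨F, hF, hFk⟩
    refine ⟨_, forest_of_pforest hneC (pforest_down hres (pforest_of_forest hF)), ?_⟩
    have hsub : {Z : Set ↥XC | Z.Nonempty ∧ ∃ B ∈ F, Z = Subtype.val ⁻¹' B} ⊆
        (fun B : Set X => (Subtype.val ⁻¹' B : Set ↥XC)) '' F := by
      rintro _ ⟨_, B, hB, rfl⟩
      exact ⟨B, hB, rfl⟩
    have h2 := Set.ncard_image_le (f := fun B : Set X => (Subtype.val ⁻¹' B : Set ↥XC))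
      (Set.toFinite F)
    exact (Set.ncard_le_ncard hsub (Set.toFinite _)).trans (h2.trans hFk)
end

section
/- For every t ≥ 3 there exist a finite set X, a set 𝒯 of t unrooted binary phylogenetic trees on X, and a common m-chain C' = (x_1,…,x_m) of 𝒯 with m = 2(t+2), such that every unrooted agreement forest for 𝒯 has size at least t+2, while the set of trees { T|(X ∖ {x_{t+1},…,x_m}) : T ∈ 𝒯 } obtained by truncating C' to length t has an unrooted agreement forest of size at most t+1. (Hence truncating common chains to length t instead of t+1 is not safe for parameter k = t+1.) -/
/-- An unrooted binary phylogenetic tree on taxon set `X`: a finite tree in which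
every internal vertex has degree 3 and the leaves (degree-1 vertices) are
bijectively labelled by `X`. -/
structure UTree (X : Type) : Type 1 where
  V : Type
  finV : Finite V
  g : SimpleGraph V
  isTree : g.IsTree
  label : X → V
  label_inj : Function.Injective label
  leaf_iff : ∀ v : V, (g.neighborSet v).ncard = 1 ↔ v ∈ Set.range label
  internal_deg : ∀ v : V, v ∉ Set.range label → (g.neighborSet v).ncard = 3

namespace UTree

variable {X : Type}

/-- Vertex set of the minimal subtree `T[B]` of `T` spanning the leaves labelled by `B`:
the vertices lying on a path between two leaves labelled by elements of `B`. -/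
def spanSet (T : UTree X) (B : Set X) : Set T.V :=
  {v | ∃ x ∈ B, ∃ y ∈ B, ∃ p : T.g.Walk (T.label x) (T.label y), p.IsPath ∧ v ∈ p.support}

/-- `deg^T(B)`: the number of edges of `T` with exactly one endpoint in `T[B]`. -/
noncomputable def blockDeg (T : UTree X) (B : Set X) : ℕ :=
  {e : Sym2 T.V | ∃ u v : T.V, T.g.Adj u v ∧ e = s(u, v) ∧
    u ∈ T.spanSet B ∧ v ∉ T.spanSet B}.ncard

/-- The vertices of `T[B]` surviving the suppression of degree-2 vertices:
the leaves labelled by `B` together with the branch points of `T[B]`. -/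
def keepSet (T : UTree X) (B : Set X) : Set T.V :=
  {v | v ∈ T.spanSet B ∧
    (v ∈ T.label '' B ∨ 3 ≤ (T.g.neighborSet v ∩ T.spanSet B).ncard)}

/-- Adjacency in the suppressed tree `T|B`: two surviving vertices joined by a path of
`T[B]` containing no other surviving vertex internally. -/
def restAdj (T : UTree X) (B : Set X) (u v : T.V) : Prop :=
  u ∈ T.keepSet B ∧ v ∈ T.keepSet B ∧ u ≠ v ∧
    ∃ p : T.g.Walk u v, p.IsPath ∧ (∀ w ∈ p.support, w ∈ T.spanSet B) ∧
      ∀ w ∈ p.support, w ∈ T.keepSet B → w = u ∨ w = v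

/-- `T|B = T'|B`: a leaf-label-preserving isomorphism between the suppressed trees. -/
def restEq (T T' : UTree X) (B : Set X) : Prop :=
  ∃ φ : T.V → T'.V, Set.BijOn φ (T.keepSet B) (T'.keepSet B) ∧
    (∀ x ∈ B, φ (T.label x) = T'.label x) ∧
    ∀ u v : T.V, u ∈ T.keepSet B → v ∈ T.keepSet B →
      (T.restAdj B u v ↔ T'.restAdj B (φ u) (φ v))

/-- `F` is a partition of `X` into nonempty blocks. -/
def IsForestPartition (F : Set (Set X)) : Prop :=
  (∀ B ∈ F, B.Nonempty) ∧ ∀ x : X, ∃! B, B ∈ F ∧ x ∈ B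

/-- An unrooted agreement forest for `𝒯`: a partition of `X` whose blocks have a common
topology in all trees and induce pairwise vertex-disjoint subtrees in each tree. -/
def IsAgreementForest (𝒯 : Set (UTree X)) (F : Set (Set X)) : Prop :=
  IsForestPartition F ∧
  (∀ B ∈ F, ∀ T ∈ 𝒯, ∀ T' ∈ 𝒯, restEq T T' B) ∧
  ∀ B ∈ F, ∀ B' ∈ F, B ≠ B' → ∀ T ∈ 𝒯, Disjoint (T.spanSet B) (T.spanSet B')

/-- `(x 0, …, x (m-1))` is a chain in `T`: the parent of each `x i` is equal to or
adjacent to the parent of `x (i+1)` (parents being the unique neighbours of the leaves). -/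
def IsChainIn (T : UTree X) {m : ℕ} (x : Fin m → X) : Prop :=
  ∀ (i : ℕ) (h1 : i + 1 < m), ∀ p q : T.V,
    T.g.Adj (T.label (x ⟨i, Nat.lt_of_succ_lt h1⟩)) p →
    T.g.Adj (T.label (x ⟨i + 1, h1⟩)) q → p = q ∨ T.g.Adj p q

/-- A common `m`-chain of `𝒯`: a sequence of `m ≥ 2` distinct taxa that is a chain in
every tree of `𝒯`. -/
def IsCommonChain (𝒯 : Set (UTree X)) {m : ℕ} (x : Fin m → X) : Prop :=
  2 ≤ m ∧ Function.Injective x ∧ ∀ T ∈ 𝒯, T.IsChainIn x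

/-- `T[S]` is pendant in `T`: deleting some edge splits `T` into two subtrees, one of
which contains exactly the leaves labelled by `S`. -/
def IsPendant (T : UTree X) (S : Set X) : Prop :=
  ∃ u v : T.V, T.g.Adj u v ∧
    ∀ x : X, (T.g.deleteEdges {s(u, v)}).Reachable u (T.label x) ↔ x ∈ S

/-- `u` is an attachment point of `T[S]`: a vertex of `T[S]` adjacent to a vertex
outside `T[S]`. -/
def attachPoint (T : UTree X) (S : Set X) (u : T.V) : Prop :=
  u ∈ T.spanSet S ∧ ∃ w : T.V, w ∉ T.spanSet S ∧ T.g.Adj u w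

/-- A label-preserving isomorphism between `T[S]` and `T'[S]` respecting the
attachment points. -/
def pendantIso (T T' : UTree X) (S : Set X) : Prop :=
  ∃ φ : T.V → T'.V, Set.BijOn φ (T.spanSet S) (T'.spanSet S) ∧
    (∀ x ∈ S, φ (T.label x) = T'.label x) ∧
    (∀ u v : T.V, u ∈ T.spanSet S → v ∈ T.spanSet S →
      (T.g.Adj u v ↔ T'.g.Adj (φ u) (φ v))) ∧
    ∀ u : T.V, attachPoint T S u → attachPoint T' S (φ u)

/-- `S` induces a common pendant subtree of `𝒯`. -/
def InducesCommonPendant (𝒯 : Set (UTree X)) (S : Set X) : Prop :=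
  S.Nonempty ∧ (∀ T ∈ 𝒯, IsPendant T S) ∧ ∀ T ∈ 𝒯, ∀ T' ∈ 𝒯, pendantIso T T' S

/-- `T'` is (isomorphic to) the restriction `T|X'` of `T` to the taxa in `X'`. -/
def IsRestrictionOf (T : UTree X) (X' : Set X) (T' : UTree X') : Prop :=
  ∃ φ : T'.V → T.V, Function.Injective φ ∧
    (∀ x : X', φ (T'.label x) = T.label x.val) ∧
    Set.range φ = T.keepSet X' ∧
    ∀ u v : T'.V, T'.g.Adj u v ↔ T.restAdj X' (φ u) (φ v)

/-- `𝒯' = { T|X' : T ∈ 𝒯 }` up to label-preserving isomorphism. -/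
def IsRestrictionFamily (𝒯 : Set (UTree X)) (X' : Set X) (𝒯' : Set (UTree X')) : Prop :=
  (∀ T' ∈ 𝒯', ∃ T ∈ 𝒯, IsRestrictionOf T X' T') ∧
  ∀ T ∈ 𝒯, ∃ T' ∈ 𝒯', IsRestrictionOf T X' T'

/-- The subtree reduction rule is applicable: some `S` with `|S| ≥ 2` induces a common
pendant subtree. -/
def SubtreeRuleApplicable (𝒯 : Set (UTree X)) : Prop :=
  ∃ S : Set X, 2 ≤ S.ncard ∧ InducesCommonPendant 𝒯 S

/-- The chain reduction rule (with truncation length `r`) is applicable: `𝒯` has a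
common `m`-chain with `m > r`. -/
def ChainRuleApplicable (𝒯 : Set (UTree X)) (r : ℕ) : Prop :=
  ∃ (m : ℕ) (x : Fin m → X), r < m ∧ IsCommonChain 𝒯 x

end UTree


namespace Cat

/-- Vertices of the caterpillar with `n` leaves: `(k, false)` is the spine vertex at position `k`
and `(k, true)` is the leaf pending at an interior position `k`. -/
def CV (n : ℕ) : Type := {p : ℕ × Bool // p.1 < n ∧ (p.2 = true → 0 < p.1 ∧ p.1 + 1 < n)}

def CV.pos {n : ℕ} (v : CV n) : ℕ := v.1.1
def CV.top {n : ℕ} (v : CV n) : Bool := v.1.2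

theorem CV.ext' {n : ℕ} {u v : CV n} (h1 : u.pos = v.pos) (h2 : u.top = v.top) : u = v :=
  Subtype.ext (Prod.ext h1 h2)

theorem CV.pos_lt {n : ℕ} (v : CV n) : v.pos < n := v.2.1
theorem CV.top_imp {n : ℕ} (v : CV n) (h : v.top = true) : 0 < v.pos ∧ v.pos + 1 < n := v.2.2 h

instance (n : ℕ) : Finite (CV n) := by
  apply Finite.of_injective (β := Fin n × Bool) (fun v => (⟨v.pos, v.pos_lt⟩, v.top))
  intro u v h
  simp only [Prod.mk.injEq, Fin.mk.injEq] at h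
  exact CV.ext' h.1 h.2

def sp {n : ℕ} (k : ℕ) (h : k < n) : CV n := ⟨(k, false), h, by simp⟩
def lf {n : ℕ} (k : ℕ) (h0 : 0 < k) (h : k + 1 < n) : CV n := ⟨(k, true), by simp; omega, by simp; omega⟩
def lab {n : ℕ} (k : ℕ) (h : k < n) : CV n :=
  ⟨(k, decide (0 < k ∧ k + 1 < n)), h, by simp⟩

@[simp] theorem sp_pos {n k : ℕ} (h : k < n) : (sp k h).pos = k := rfl
@[simp] theorem sp_top {n k : ℕ} (h : k < n) : (sp k h).top = false := rfl
@[simp] theorem lf_pos {n k : ℕ} (h0 : 0 < k) (h : k + 1 < n) : (lf k h0 h).pos = k := rfl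
@[simp] theorem lf_top {n k : ℕ} (h0 : 0 < k) (h : k + 1 < n) : (lf k h0 h).top = true := rfl
@[simp] theorem lab_pos {n k : ℕ} (h : k < n) : (lab k h).pos = k := rfl
@[simp] theorem lab_top {n k : ℕ} (h : k < n) :
    (lab k h).top = decide (0 < k ∧ k + 1 < n) := rfl

theorem CV.eq_iff {n : ℕ} {u v : CV n} : u = v ↔ u.pos = v.pos ∧ u.top = v.top :=
  ⟨by rintro rfl; simp, fun h => CV.ext' h.1 h.2⟩

def G (n : ℕ) : SimpleGraph (CV n) where
  Adj u v := (u.top = false ∧ v.top = false ∧ (u.pos + 1 = v.pos ∨ v.pos + 1 = u.pos)) ∨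
    (u.pos = v.pos ∧ u.top ≠ v.top)
  symm := ⟨by intro u v h; grind⟩
  loopless := ⟨by intro u h; grind⟩

theorem adj_iff {n : ℕ} {u v : CV n} : (G n).Adj u v ↔
    (u.top = false ∧ v.top = false ∧ (u.pos + 1 = v.pos ∨ v.pos + 1 = u.pos)) ∨
    (u.pos = v.pos ∧ u.top ≠ v.top) := Iff.rfl

/-- walk between two vertices with support in a set -/
def Conn {V : Type} (g : SimpleGraph V) (S : V → Prop) (u v : V) : Prop :=
  ∃ w : g.Walk u v, ∀ x ∈ w.support, S x

theorem Conn.refl {V : Type} {g : SimpleGraph V} {S : V → Prop} {u : V} (h : S u) :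
    Conn g S u u := ⟨.nil, by simpa using h⟩
theorem Conn.trans {V : Type} {g : SimpleGraph V} {S : V → Prop} {u v w : V}
    (h : Conn g S u v) (h' : Conn g S v w) : Conn g S u w := by
  obtain ⟨p, hp⟩ := h
  obtain ⟨q, hq⟩ := h'
  refine ⟨p.append q, fun x hx => ?_⟩
  rw [SimpleGraph.Walk.mem_support_append_iff] at hx
  exact hx.elim (hp x) (hq x)
theorem Conn.symm {V : Type} {g : SimpleGraph V} {S : V → Prop} {u v : V}
    (h : Conn g S u v) : Conn g S v u := by
  obtain ⟨p, hp⟩ := h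
  exact ⟨p.reverse, by simpa using hp⟩
theorem Conn.adj {V : Type} {g : SimpleGraph V} {S : V → Prop} {u v : V}
    (h : g.Adj u v) (hu : S u) (hv : S v) : Conn g S u v :=
  ⟨h.toWalk, by simp [hu, hv]⟩
theorem Conn.mono {V : Type} {g : SimpleGraph V} {S S' : V → Prop} {u v : V}
    (h : Conn g S u v) (hS : ∀ x, S x → S' x) : Conn g S' u v := by
  obtain ⟨p, hp⟩ := h
  exact ⟨p, fun x hx => hS x (hp x hx)⟩

theorem conn_toSpine {n : ℕ} (p : CV n) :
    Conn (G n) (fun v => v = p ∨ v = sp p.pos p.pos_lt) p (sp p.pos p.pos_lt) := by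
  by_cases h : p.top = true
  · refine Conn.adj ?_ (by simp) (by simp)
    rw [adj_iff]; simp [h]
  · have : p = sp p.pos p.pos_lt := CV.ext' (by simp) (by simpa using h)
    rw [← this]; exact Conn.refl (Or.inl rfl)

theorem conn_spine {n : ℕ} (i j : ℕ) (hij : i ≤ j) (hj : j < n) :
    Conn (G n) (fun v => v.top = false ∧ i ≤ v.pos ∧ v.pos ≤ j)
      (sp i (lt_of_le_of_lt hij hj)) (sp j hj) := by
  induction j, hij using Nat.le_induction with
  | base => exact Conn.refl (by simp)
  | succ j hij ih =>
    have := ih (by omega)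
    refine (this.mono (by grind)).trans (Conn.adj ?_ ?_ ?_)
    · rw [adj_iff]; simp
    · simp; omega
    · simp; omega

/-- the explicit walk -/
theorem conn_path {n : ℕ} (p q : CV n) (h : p.pos ≤ q.pos) :
    Conn (G n) (fun v => v = p ∨ v = q ∨ (p ≠ q ∧ v.top = false ∧ p.pos ≤ v.pos ∧ v.pos ≤ q.pos))
      p q := by
  by_cases hpq : p = q
  · subst hpq; exact Conn.refl (Or.inl rfl)
  · have hs := h
    refine ((conn_toSpine p).mono ?_).trans
      (((conn_spine p.pos q.pos h q.pos_lt).mono ?_).trans ((conn_toSpine q).mono ?_).symm)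
    · rintro v (rfl | rfl) <;> simp [hpq, h]
    · intro v hv; simp [hpq, hv]
    · rintro v (rfl | rfl) <;> simp [hpq, h]

/-- crossing lemma -/
theorem crossing {n : ℕ} {p q : CV n} (w : (G n).Walk p q) (k : ℕ) (hk : k < n)
    (h1 : p.pos ≤ k) (h2 : k ≤ q.pos) (h3 : p.pos < q.pos) : sp k hk ∈ w.support := by
  induction w with
  | nil => omega
  | @cons p r q hpr w ih =>
    rw [SimpleGraph.Walk.support_cons, List.mem_cons]
    by_cases hp : p = sp k hk
    · exact Or.inl hp.symm
    right
    rw [adj_iff] at hpr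
    simp only [CV.eq_iff, sp_pos, sp_top] at hp
    by_cases hr : r = sp k hk
    · rw [← hr]; simp
    simp only [CV.eq_iff, sp_pos, sp_top] at hr
    apply ih <;> grind

theorem connected (n : ℕ) (hn : 2 ≤ n) : (G n).Connected := by
  have : Nonempty (CV n) := ⟨sp 0 (by omega)⟩
  refine ⟨fun u v => ?_⟩
  rcases le_total u.pos v.pos with h | h
  · obtain ⟨w, -⟩ := conn_path u v h
    exact ⟨w⟩
  · obtain ⟨w, -⟩ := conn_path v u h
    exact ⟨w.reverse⟩

theorem reach_inv {V : Type} {g : SimpleGraph V} (P : V → Prop)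
    (hP : ∀ x y, g.Adj x y → P x → P y) {u v : V} (h : g.Reachable u v) (hu : P u) : P v := by
  obtain ⟨w⟩ := h
  induction w with
  | nil => exact hu
  | cons hadj _ ih => exact ih (hP _ _ hadj hu)

theorem acyclic (n : ℕ) : (G n).IsAcyclic := by
  rw [SimpleGraph.isAcyclic_iff_forall_adj_isBridge]
  intro u v huv
  wlog hw : (u.top = false ∧ v.top = false ∧ u.pos + 1 = v.pos) ∨
    (u.pos = v.pos ∧ u.top = true ∧ v.top = false) with H
  · rw [Sym2.eq_swap]
    apply H n huv.symm
    rw [adj_iff] at huv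
    grind
  rw [SimpleGraph.isBridge_iff]
  intro hr
  rcases hw with ⟨h1, h2, h3⟩ | ⟨h1, h2, h3⟩
  · have := reach_inv (fun x => x.pos ≤ u.pos) ?_ hr le_rfl
    · omega
    · intro x y hxy hx
      simp only [SimpleGraph.deleteEdges_adj, adj_iff, Set.mem_singleton_iff, Sym2.eq_iff,
        CV.eq_iff] at hxy
      grind
  · have := reach_inv (fun x => x = u) ?_ hr rfl
    · subst this; simp_all
    · rintro x y hxy rfl
      simp only [SimpleGraph.deleteEdges_adj, adj_iff, Set.mem_singleton_iff, Sym2.eq_iff,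
        CV.eq_iff] at hxy
      grind

theorem isTree (n : ℕ) (hn : 2 ≤ n) : (G n).IsTree := ⟨connected n hn, acyclic n⟩

theorem nb_lf {n : ℕ} (v : CV n) (h : v.top = true) :
    (G n).neighborSet v = {sp v.pos v.pos_lt} := by
  ext u; simp only [SimpleGraph.mem_neighborSet, adj_iff, Set.mem_singleton_iff, CV.eq_iff]
  simp [h]; grind

theorem nb_sp {n : ℕ} (v : CV n) (h : v.top = false) (h0 : 0 < v.pos) (h1 : v.pos + 1 < n) :
    (G n).neighborSet v = {sp (v.pos - 1) (by omega), sp (v.pos + 1) h1, lf v.pos h0 h1} := by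
  ext u; simp only [SimpleGraph.mem_neighborSet, adj_iff, Set.mem_singleton_iff, CV.eq_iff,
    Set.mem_insert_iff, sp_pos, sp_top, lf_pos, lf_top]
  grind

theorem nb_zero {n : ℕ} (hn : 2 ≤ n) (v : CV n) (h0 : v.pos = 0) :
    (G n).neighborSet v = {sp 1 (by omega)} := by
  ext u; simp only [SimpleGraph.mem_neighborSet, adj_iff, Set.mem_singleton_iff, CV.eq_iff,
    sp_pos, sp_top]
  have := u.top_imp; have := v.top_imp
  cases hu : u.top <;> cases hv : v.top <;> grind

theorem nb_last {n : ℕ} (hn : 2 ≤ n) (v : CV n) (h0 : v.pos + 1 = n) :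
    (G n).neighborSet v = {sp (n - 2) (by omega)} := by
  ext u; simp only [SimpleGraph.mem_neighborSet, adj_iff, Set.mem_singleton_iff, CV.eq_iff,
    sp_pos, sp_top]
  have := u.top_imp; have := v.top_imp; have := u.pos_lt
  cases hu : u.top <;> cases hv : v.top <;> grind

theorem ncard_sp {n : ℕ} (v : CV n) (h : v.top = false) (h0 : 0 < v.pos) (h1 : v.pos + 1 < n) :
    ((G n).neighborSet v).ncard = 3 := by
  rw [nb_sp v h h0 h1, Set.ncard_eq_three]
  refine ⟨_, _, _, ?_, ?_, ?_, rfl⟩ <;> simp [CV.eq_iff]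

/-- is a leaf vertex -/
def Leaf {n : ℕ} (v : CV n) : Prop := v.top = true ∨ v.pos = 0 ∨ v.pos + 1 = n

theorem ncard_leaf {n : ℕ} (hn : 2 ≤ n) (v : CV n) (h : Leaf v) :
    ((G n).neighborSet v).ncard = 1 := by
  rcases h with h | h | h
  · rw [nb_lf v h, Set.ncard_singleton]
  · rw [nb_zero hn v h, Set.ncard_singleton]
  · rw [nb_last hn v h, Set.ncard_singleton]

theorem leaf_iff_range {X : Type} {n : ℕ} (σ : X ≃ Fin n) (v : CV n) :
    Leaf v ↔ v ∈ Set.range (fun x => lab (σ x : ℕ) (σ x).2) := by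
  constructor
  · intro h
    refine ⟨σ.symm ⟨v.pos, v.pos_lt⟩, ?_⟩
    apply CV.ext'
    · simp
    · have := v.top_imp
      simp [Leaf] at h ⊢
      grind
  · rintro ⟨x, rfl⟩
    simp only [Leaf, lab_pos, lab_top, decide_eq_true_eq]
    omega

def cat {X : Type} {n : ℕ} (hn : 2 ≤ n) (σ : X ≃ Fin n) : UTree X where
  V := CV n
  finV := inferInstance
  g := G n
  isTree := isTree n hn
  label x := lab (σ x : ℕ) (σ x).2
  label_inj := by
    intro x y h
    have := congrArg CV.pos h
    simp at this
    exact σ.injective (Fin.ext this)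
  leaf_iff v := by
    rw [← leaf_iff_range]
    refine ⟨fun h => ?_, ncard_leaf hn v⟩
    by_contra hl
    simp only [Leaf, not_or, Bool.not_eq_true] at hl
    have := v.pos_lt
    rw [ncard_sp v hl.1 (by omega) (by omega)] at h
    omega
  internal_deg v h := by
    rw [← leaf_iff_range] at h
    simp only [Leaf, not_or, Bool.not_eq_true] at h
    have := v.pos_lt
    exact ncard_sp v h.1 (by omega) (by omega)

theorem path_sub {V : Type} {g : SimpleGraph V} (hg : g.IsAcyclic) {u v : V} (p : g.Walk u v)
    (hp : p.IsPath) {S : V → Prop} (h : Conn g S u v) : ∀ x ∈ p.support, S x := by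
  classical
  obtain ⟨w, hw⟩ := h
  have := (hg.subsingleton_path u v).elim ⟨p, hp⟩ ⟨w.bypass, w.bypass_isPath⟩
  have h2 : p = w.bypass := congrArg Subtype.val this
  intro x hx
  rw [h2] at hx
  exact hw x (w.support_bypass_subset_support hx)

theorem conn_path_of {V : Type} {g : SimpleGraph V} {u v : V} {S : V → Prop} (h : Conn g S u v) :
    ∃ p : g.Walk u v, p.IsPath ∧ ∀ x ∈ p.support, S x := by
  classical
  obtain ⟨w, hw⟩ := h
  exact ⟨w.bypass, w.bypass_isPath, fun x hx => hw x (w.support_bypass_subset_support hx)⟩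

section
variable {X : Type} {n : ℕ} (hn : 2 ≤ n) (σ : X ≃ Fin n)

theorem label_def (x : X) : (cat hn σ).label x = lab (σ x : ℕ) (σ x).2 := rfl

theorem mem_span (B : Set X) (v : CV n) : v ∈ (cat hn σ).spanSet B ↔
    (∃ x ∈ B, v = lab (σ x : ℕ) (σ x).2) ∨
    (v.top = false ∧ ∃ x ∈ B, ∃ z ∈ B, (σ x : ℕ) < σ z ∧ (σ x : ℕ) ≤ v.pos ∧ v.pos ≤ σ z) := by
  constructor
  · rintro ⟨x, hx, y, hy, p, hp, hv⟩
    change (G n).Walk (lab (σ x : ℕ) (σ x).2) (lab (σ y : ℕ) (σ y).2) at p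
    rcases le_total (σ x : ℕ) (σ y) with h | h
    · have := path_sub (acyclic n) p hp (conn_path _ _ h) v hv
      rcases this with h1 | h1 | ⟨h1, h2, h3, h4⟩
      · exact Or.inl ⟨x, hx, h1⟩
      · exact Or.inl ⟨y, hy, h1⟩
      · refine Or.inr ⟨h2, x, hx, y, hy, ?_, h3, h4⟩
        by_contra hh
        apply h1
        simp only [CV.eq_iff, lab_pos, lab_top]
        have : (σ x : ℕ) = σ y := by omega
        simp [this]
    · have := path_sub (acyclic n) p hp (conn_path (lab (σ y : ℕ) (σ y).2) (lab (σ x : ℕ) (σ x).2) h).symm v hv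
      rcases this with h1 | h1 | ⟨h1, h2, h3, h4⟩
      · exact Or.inl ⟨y, hy, h1⟩
      · exact Or.inl ⟨x, hx, h1⟩
      · refine Or.inr ⟨h2, y, hy, x, hx, ?_, h3, h4⟩
        by_contra hh
        apply h1
        simp only [CV.eq_iff, lab_pos, lab_top]
        have : (σ x : ℕ) = σ y := by omega
        simp [this]
  · rintro (⟨x, hx, rfl⟩ | ⟨h, x, hx, z, hz, h1, h2, h3⟩)
    · exact ⟨x, hx, x, hx, .nil, by simp, by rw [SimpleGraph.Walk.support_nil]; exact List.mem_singleton.2 rfl⟩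
    · obtain ⟨p, hp, -⟩ := conn_path_of (conn_path (lab (σ x : ℕ) (σ x).2) (lab (σ z : ℕ) (σ z).2) h1.le)
      refine ⟨x, hx, z, hz, p, hp, ?_⟩
      have := crossing p v.pos v.pos_lt h2 h3 h1
      have hv : v = sp v.pos v.pos_lt := CV.ext' rfl h
      rw [hv]; exact this

theorem label_mem_span (B : Set X) (x : X) :
    (cat hn σ).label x ∈ (cat hn σ).spanSet B ↔ x ∈ B := by
  rw [label_def]
  refine (mem_span hn σ B _).trans ⟨?_, fun h => Or.inl ⟨x, h, rfl⟩⟩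
  rintro (⟨y, hy, h⟩ | ⟨h, y, hy, z, hz, h1, h2, h3⟩)
  · have := (cat hn σ).label_inj h
    rwa [this]
  · simp only [lab_top, lab_pos, decide_eq_false_iff_not] at h h2 h3
    have := (σ z).2
    have : (σ x : ℕ) = σ y ∨ (σ x : ℕ) = σ z := by omega
    rcases this with h | h
    · rwa [σ.injective (Fin.ext h)]
    · rwa [σ.injective (Fin.ext h)]

theorem mem_keep (B : Set X) (v : CV n) : v ∈ (cat hn σ).keepSet B ↔
    (∃ x ∈ B, v = lab (σ x : ℕ) (σ x).2) ∨
    (v.top = false ∧ ∃ x ∈ B, ∃ y ∈ B, ∃ z ∈ B, (σ x : ℕ) < σ y ∧ (σ y : ℕ) < σ z ∧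
      v.pos = σ y) := by
  constructor
  · rintro ⟨hv, (⟨x, hx, h⟩ | h)⟩
    · exact Or.inl ⟨x, hx, h.symm⟩
    change 3 ≤ ((G n).neighborSet v ∩ (cat hn σ).spanSet B).ncard at h
    have hle : ((G n).neighborSet v ∩ (cat hn σ).spanSet B).ncard ≤ ((G n).neighborSet v).ncard :=
      Set.ncard_le_ncard Set.inter_subset_left (Set.toFinite _)
    have hnl : ¬ Leaf v := by
      intro hl
      rw [ncard_leaf hn v hl] at hle
      omega
    simp only [Leaf, not_or, Bool.not_eq_true] at hnl
    have hlt := v.pos_lt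
    have h0 : 0 < v.pos := by omega
    have h1 : v.pos + 1 < n := by omega
    have heq : (G n).neighborSet v ∩ (cat hn σ).spanSet B = (G n).neighborSet v := by
      apply Set.eq_of_subset_of_ncard_le Set.inter_subset_left _ (Set.toFinite _)
      rw [ncard_sp v hnl.1 h0 h1]; exact h
    replace heq := Set.inter_eq_left.1 heq
    rw [nb_sp v hnl.1 h0 h1] at heq
    have a1 := (mem_span hn σ B _).1 (heq (a := sp (v.pos - 1) (by omega)) (by simp))
    have a2 := (mem_span hn σ B _).1 (heq (a := sp (v.pos + 1) h1) (by simp))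
    have a3 := (mem_span hn σ B _).1 (heq (a := lf v.pos h0 h1) (by simp))
    simp only [CV.eq_iff, sp_pos, sp_top, lf_pos, lf_top, lab_pos, lab_top] at a1 a2 a3
    right
    refine ⟨hnl.1, ?_⟩
    obtain ⟨y, hy, hy1, -⟩ : ∃ x ∈ B, v.pos = ↑(σ x) ∧ true = decide (0 < (σ x : ℕ) ∧ (σ x : ℕ) + 1 < n) := by
      simpa using a3
    obtain ⟨x, hx, hx1⟩ : ∃ x ∈ B, (σ x : ℕ) < v.pos := by
      rcases a1 with ⟨x, hx, h, -⟩ | ⟨-, x, hx, z, hz, h, h', -⟩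
      · exact ⟨x, hx, by omega⟩
      · exact ⟨x, hx, by omega⟩
    obtain ⟨z, hz, hz1⟩ : ∃ x ∈ B, v.pos < (σ x : ℕ) := by
      rcases a2 with ⟨x, hx, h, -⟩ | ⟨-, x, hx, z, hz, h, h', h''⟩
      · exact ⟨x, hx, by omega⟩
      · exact ⟨z, hz, by omega⟩
    exact ⟨x, hx, y, hy, z, hz, by omega, by omega, hy1⟩
  · rintro (⟨x, hx, rfl⟩ | ⟨h, x, hx, y, hy, z, hz, h1, h2, h3⟩)
    · exact ⟨(label_mem_span hn σ B x).2 hx, Or.inl ⟨x, hx, rfl⟩⟩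
    · refine ⟨(mem_span hn σ B v).2 (Or.inr ⟨h, x, hx, z, hz, by omega, by omega, by omega⟩), Or.inr ?_⟩
      change 3 ≤ ((G n).neighborSet v ∩ (cat hn σ).spanSet B).ncard
      have := (σ z).2
      have h0 : 0 < v.pos := by omega
      have h1 : v.pos + 1 < n := by omega
      have heq : (G n).neighborSet v ∩ (cat hn σ).spanSet B = (G n).neighborSet v := by
        refine Set.inter_eq_left.2 ?_
        rw [nb_sp v h h0 h1]
        rintro u (rfl | rfl | rfl)
        · exact (mem_span hn σ B _).2 (Or.inr ⟨rfl, x, hx, z, hz, by omega, by simp; omega, by simp; omega⟩)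
        · exact (mem_span hn σ B _).2 (Or.inr ⟨rfl, x, hx, z, hz, by omega, by simp; omega, by simp; omega⟩)
        · refine (mem_span hn σ B _).2 (Or.inl ⟨y, hy, ?_⟩)
          rw [CV.eq_iff]; simp; omega
      rw [heq, ncard_sp v h h0 h1]

end

theorem restAdj_symm {X : Type} {T : UTree X} {B : Set X} {u v : T.V} (h : T.restAdj B u v) :
    T.restAdj B v u := by
  obtain ⟨h1, h2, h3, p, hp, h4, h5⟩ := h
  refine ⟨h2, h1, h3.symm, p.reverse, hp.reverse, ?_, ?_⟩
  · simpa using h4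
  · intro w hw hk
    exact (h5 w (by simpa using hw) hk).symm

theorem restEq_of_restr {X : Type} {T T' : UTree X} {B : Set X} {R : UTree B}
    (h : UTree.IsRestrictionOf T B R) (h' : UTree.IsRestrictionOf T' B R) :
    UTree.restEq T T' B := by
  obtain ⟨ψ, hi, hl, hr, ha⟩ := h
  obtain ⟨ψ', hi', hl', hr', ha'⟩ := h'
  have hne : Nonempty R.V := R.isTree.1.nonempty
  have hinv : ∀ r, Function.invFun ψ (ψ r) = r := Function.leftInverse_invFun hi
  refine ⟨fun v => ψ' (Function.invFun ψ v), ⟨?_, ?_, ?_⟩, ?_, ?_⟩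
  · intro v _
    rw [← hr']; exact ⟨_, rfl⟩
  · intro u hu v hv h
    rw [← hr] at hu hv
    obtain ⟨u, rfl⟩ := hu
    obtain ⟨v, rfl⟩ := hv
    simp only [hinv] at h
    rw [hi' h]
  · intro v hv
    rw [← hr'] at hv
    obtain ⟨r, rfl⟩ := hv
    exact ⟨ψ r, by rw [← hr]; exact ⟨r, rfl⟩, by simp only [hinv]⟩
  · intro x hx
    have := hl ⟨x, hx⟩
    simp only at this
    rw [← this]
    simp only [hinv, hl']
  · intro u v hu hv
    rw [← hr] at hu hv
    obtain ⟨u, rfl⟩ := hu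
    obtain ⟨v, rfl⟩ := hv
    simp only [hinv]
    rw [← ha, ha']

set_option maxHeartbeats 1600000 in
theorem restr_cat {X : Type} {n k : ℕ} (hn : 2 ≤ n) (hk : 2 ≤ k) (σ : X ≃ Fin n) (B : Set X)
    (τ : B ≃ Fin k) (h : ∀ a b : B, τ a < τ b → (σ a : ℕ) < σ b) :
    UTree.IsRestrictionOf (cat hn σ) B (cat hk τ) := by
  classical
  -- position of the `j`-th element
  obtain ⟨e, he⟩ : ∃ e : ℕ → ℕ, ∀ b : B, e (τ b) = σ b :=
    ⟨fun j => if hj : j < k then σ (τ.symm ⟨j, hj⟩ : B) else 0, fun b => by simp⟩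
  have hex : ∀ j, j < k → ∃ b : B, (τ b : ℕ) = j := fun j hj => ⟨τ.symm ⟨j, hj⟩, by simp⟩
  have hmono : ∀ i j, i < j → j < k → e i < e j := by
    intro i j hij hj
    obtain ⟨a, rfl⟩ := hex i (by omega)
    obtain ⟨b, rfl⟩ := hex j hj
    rw [he, he]; exact h a b hij
  have hlt : ∀ i, i < k → e i < n := by
    intro i hi
    obtain ⟨a, rfl⟩ := hex i hi
    rw [he]; exact (σ a).2
  have hinj : ∀ i j, i < k → j < k → e i = e j → i = j := by
    intro i j hi hj hij
    rcases lt_trichotomy i j with h | h | h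
    · have := hmono i j h hj; omega
    · exact h
    · have := hmono j i h hi; omega
  have hint : ∀ i, 0 < i → i + 1 < k → 0 < e i ∧ e i + 1 < n := by
    intro i hi hik
    have := hmono 0 i hi (by omega)
    have := hmono i (i+1) (by omega) (by omega)
    have := hlt (i+1) (by omega)
    omega
  have hrev : ∀ a b : B, (σ a : ℕ) < σ b → (τ a : ℕ) < τ b := by
    intro a b hab
    by_contra hc
    have : τ b = τ a ∨ τ b < τ a := by rw [Fin.lt_def, Fin.ext_iff]; omega
    rcases this with hh | hh
    · rw [τ.injective hh] at hab; omega
    · have := h b a hh; omega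
  let ψ : CV k → CV n := fun v => if Leaf v then lab (e v.pos) (hlt _ v.pos_lt)
    else sp (e v.pos) (hlt _ v.pos_lt)
  have hψpos : ∀ v, (ψ v).pos = e v.pos := by
    intro v; simp only [ψ]; split <;> simp
  have hψleaf : ∀ v, Leaf v → ψ v = lab (e v.pos) (hlt _ v.pos_lt) := by
    intro v hv; simp only [ψ, if_pos hv]
  have hψsp : ∀ v, ¬ Leaf v → ψ v = sp (e v.pos) (hlt _ v.pos_lt) := by
    intro v hv; simp only [ψ, if_neg hv]
  have hkeepsp : ∀ j (h0 : 0 < j) (h1 : j + 1 < k), sp (e j) (hlt _ (by omega)) ∈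
      (cat hn σ).keepSet B := by
    intro j h0 h1
    obtain ⟨a, ha⟩ := hex 0 (by omega)
    obtain ⟨b, rfl⟩ := hex j (by omega)
    obtain ⟨c, hc⟩ := hex (τ b + 1) h1
    refine (mem_keep hn σ B _).2 (Or.inr ⟨rfl, a, a.2, b, b.2, c, c.2, ?_, ?_, ?_⟩)
    · exact h a b (by rw [Fin.lt_def]; omega)
    · exact h b c (by rw [Fin.lt_def]; omega)
    · simp [he]
  have hkeeplab : ∀ j (hj : j < k), lab (e j) (hlt _ hj) ∈ (cat hn σ).keepSet B := by
    intro j hj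
    obtain ⟨b, rfl⟩ := hex j hj
    refine (mem_keep hn σ B _).2 (Or.inl ⟨b, b.2, ?_⟩)
    simp [he]
  have hψkeep : ∀ v, ψ v ∈ (cat hn σ).keepSet B := by
    intro v
    by_cases hv : Leaf v
    · rw [hψleaf v hv]; exact hkeeplab _ v.pos_lt
    · rw [hψsp v hv]
      simp only [Leaf, not_or] at hv
      have := v.pos_lt
      exact hkeepsp _ (by omega) (by omega)
  have hψinj : Function.Injective ψ := by
    intro u v huv
    have h1 : u.pos = v.pos := by
      apply hinj _ _ u.pos_lt v.pos_lt
      rw [← hψpos, ← hψpos, huv]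
    by_contra hne
    have h2 : u.top ≠ v.top := fun h => hne (CV.ext' h1 h)
    have h3 := u.top_imp
    have h4 := v.top_imp
    have h5 : 0 < u.pos ∧ u.pos + 1 < k := by grind
    have h6 := hint u.pos h5.1 h5.2
    have hu : Leaf u ↔ u.top = true := by unfold Leaf; grind
    have hv : Leaf v ↔ v.top = true := by unfold Leaf; grind
    have h7 := congrArg CV.top huv
    cases hut : u.top <;> cases hvt : v.top
    · simp_all
    · rw [hψsp u (by simp [hu, hut]), hψleaf v (by simp [hv, hvt])] at h7
      simp only [sp_top, lab_top, ← h1] at h7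
      simp [h6] at h7
    · rw [hψleaf u (by simp [hu, hut]), hψsp v (by simp [hv, hvt])] at h7
      simp only [sp_top, lab_top] at h7
      simp [h6] at h7
    · simp_all
  refine ⟨ψ, hψinj, ?_, ?_, ?_⟩
  · intro b
    have hl : Leaf ((cat hk τ).label b) := (leaf_iff_range τ _).2 ⟨b, rfl⟩
    rw [hψleaf _ hl]
    change lab (e (τ b)) _ = lab (σ b : ℕ) (σ b).2
    simp [he]
  · apply Set.Subset.antisymm
    · rintro _ ⟨v, rfl⟩; exact hψkeep v
    · intro v hv
      rcases (mem_keep hn σ B v).1 hv with ⟨x, hx, rfl⟩ | ⟨ht, x, hx, y, hy, z, hz, h1, h2, h3⟩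
      · refine ⟨lab (τ ⟨x, hx⟩ : ℕ) (τ ⟨x, hx⟩).2, ?_⟩
        rw [hψleaf _ ((leaf_iff_range τ _).2 ⟨⟨x, hx⟩, rfl⟩)]
        simp [he]
        rfl
      · have g1 := hrev ⟨x, hx⟩ ⟨y, hy⟩ h1
        have g2 := hrev ⟨y, hy⟩ ⟨z, hz⟩ h2
        have g3 := (τ ⟨z, hz⟩).2
        refine ⟨sp (τ ⟨y, hy⟩ : ℕ) (τ ⟨y, hy⟩).2, ?_⟩
        rw [hψsp]
        · apply CV.ext'
          · simp [he, h3]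
          · simp [ht]
        · simp only [Leaf, sp_top, sp_pos]
          simp; omega
  · -- adjacency
    have hfwd : ∀ u v : CV k, u.pos ≤ v.pos → (G k).Adj u v →
        (cat hn σ).restAdj B (ψ u) (ψ v) := by
      intro u v huv hadj
      have hne : u ≠ v := hadj.ne
      have hle : (ψ u).pos ≤ (ψ v).pos := by
        rw [hψpos, hψpos]
        rcases huv.lt_or_eq with h | h
        · exact (hmono _ _ h v.pos_lt).le
        · rw [h]
      obtain ⟨p, hp, hps⟩ := conn_path_of (conn_path (ψ u) (ψ v) hle)
      have hps' : ∀ w ∈ p.support, w = ψ u ∨ w = ψ v ∨ (v.pos = u.pos + 1 ∧ u.top = false ∧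
          v.top = false ∧ w.top = false ∧ e u.pos ≤ w.pos ∧ w.pos ≤ e v.pos) := by
        intro w hw
        rcases hps w hw with h1 | h1 | ⟨h1, h2, h3, h4⟩
        · exact Or.inl h1
        · exact Or.inr (Or.inl h1)
        rw [hψpos] at h3 h4
        rcases huv.lt_or_eq with hl | hl
        · right; right
          rw [adj_iff] at hadj
          refine ⟨?_, ?_, ?_, h2, h3, h4⟩ <;> grind
        · have h5 : u.top ≠ v.top := fun hh => hne (CV.ext' hl hh)
          have h3' := u.top_imp
          have h4' := v.top_imp
          have hI : 0 < u.pos ∧ u.pos + 1 < k := by grind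
          cases hut : u.top
          · left
            rw [hψsp u (by simp only [Leaf]; grind)]
            apply CV.ext'
            · simp; rw [← hl] at h4; omega
            · simp [h2]
          · right; left
            rw [hψsp v (by simp only [Leaf]; grind)]
            apply CV.ext'
            · simp; rw [hl] at h3; omega
            · simp [h2]
      refine ⟨hψkeep u, hψkeep v, hψinj.ne hne, p, hp, ?_, ?_⟩
      · intro w hw
        rcases hps' w hw with rfl | rfl | ⟨h1, h2, h3, h4, h5, h6⟩
        · exact (hψkeep u).1
        · exact (hψkeep v).1
        obtain ⟨a, ha⟩ := hex u.pos u.pos_lt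
        obtain ⟨b, hb⟩ := hex v.pos v.pos_lt
        refine (mem_span hn σ B w).2 (Or.inr ⟨h4, a, a.2, b, b.2, ?_, ?_, ?_⟩)
        · rw [← he, ← he]; exact hmono _ _ (by omega) (by omega)
        · rw [← he, ha]; exact h5
        · rw [← he, hb]; exact h6
      · intro w hw hkw
        rcases hps' w hw with h1 | h1 | ⟨h1, h2, h3, h4, h5, h6⟩
        · exact Or.inl h1
        · exact Or.inr h1
        have hcase : ∀ y : B, w.pos = σ y → (τ y : ℕ) = u.pos ∨ (τ y : ℕ) = v.pos := by
          intro y hy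
          rw [← he] at hy
          by_contra hc
          rcases Nat.lt_or_ge (τ y) u.pos with hh | hh
          · have := hmono _ _ hh u.pos_lt; omega
          · have := hmono v.pos (τ y) (by omega) (τ y).2; omega
        have hkey : ∀ r : CV k, r.top = false → w.pos = e r.pos →
            ((w = lab (e r.pos) (hlt _ r.pos_lt)) ∨ (0 < r.pos ∧ r.pos + 1 < k)) → w = ψ r := by
          intro r hr hwr hor
          by_cases hL : Leaf r
          · rw [hψleaf r hL]
            rcases hor with hor | hor
            · exact hor
            · rcases hL with hL | hL | hL
              · rw [hr] at hL; simp at hL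
              · omega
              · omega
          · rw [hψsp r hL]; exact CV.ext' hwr h4
        rcases (mem_keep hn σ B w).1 hkw with ⟨x, hx, hwx⟩ | ⟨_, x, hx, y, hy, z, hz, g1, g2, g3⟩
        · have hwp : w.pos = σ x := by rw [hwx]; rfl
          have hxe := he ⟨x, hx⟩
          simp only at hxe
          rcases hcase ⟨x, hx⟩ hwp with hh | hh
          · rw [hh] at hxe
            exact Or.inl (hkey u h2 (by omega) (Or.inl (by rw [hwx]; simp [hxe]; rfl)))
          · rw [hh] at hxe
            exact Or.inr (hkey v h3 (by omega) (Or.inl (by rw [hwx]; simp [hxe]; rfl)))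
        · have hye := he ⟨y, hy⟩
          simp only at hye
          have g4 := hrev ⟨x, hx⟩ ⟨y, hy⟩ g1
          have g5 := hrev ⟨y, hy⟩ ⟨z, hz⟩ g2
          have g6 := (τ ⟨z, hz⟩).2
          rcases hcase ⟨y, hy⟩ g3 with hh | hh
          · rw [hh] at hye
            exact Or.inl (hkey u h2 (by omega) (Or.inr (by omega)))
          · rw [hh] at hye
            exact Or.inr (hkey v h3 (by omega) (Or.inr (by omega)))
    have hbwd : ∀ u v : CV k, u.pos ≤ v.pos → (cat hn σ).restAdj B (ψ u) (ψ v) →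
        (G k).Adj u v := by
      intro u v huv ⟨_, _, hne, p, hp, hps, hpk⟩
      have hne : u ≠ v := fun hh => hne (congrArg ψ hh)
      rcases huv.lt_or_eq with hlt' | heq
      · have hee := hmono _ _ hlt' v.pos_lt
        have cross : ∀ j (hj : j < n), e u.pos ≤ j → j ≤ e v.pos →
            sp j hj ∈ (cat hn σ).keepSet B → sp j hj = ψ u ∨ sp j hj = ψ v := by
          intro j hj h1 h2 h3
          refine hpk _ ?_ h3
          exact crossing (p := ψ u) (q := ψ v) p j hj (by rw [hψpos]; exact h1)
            (by rw [hψpos]; exact h2) (by rw [hψpos, hψpos]; exact hee)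
        have htop : ∀ r : CV k, r.top = true → e u.pos ≤ e r.pos → e r.pos ≤ e v.pos →
            sp (e r.pos) (hlt _ r.pos_lt) ≠ ψ r ∧ (sp (e r.pos) (hlt _ r.pos_lt) = ψ u ∨
              sp (e r.pos) (hlt _ r.pos_lt) = ψ v) := by
          intro r hr h1 h2
          have hI := r.top_imp hr
          refine ⟨?_, cross _ _ h1 h2 (hkeepsp _ hI.1 hI.2)⟩
          intro hh
          rw [hψleaf r (Or.inl hr)] at hh
          have := congrArg CV.top hh
          have hJ := hint _ hI.1 hI.2
          simp [hJ] at this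
        have hut : u.top = false := by
          by_contra hc
          obtain ⟨h1, h2 | h2⟩ := htop u (by simpa using hc) le_rfl hee.le
          · exact h1 h2
          · have := congrArg CV.pos h2
            rw [hψpos] at this; simp at this; omega
        have hvt : v.top = false := by
          by_contra hc
          obtain ⟨h1, h2 | h2⟩ := htop v (by simpa using hc) hee.le le_rfl
          · have := congrArg CV.pos h2
            rw [hψpos] at this; simp at this; omega
          · exact h1 h2
        have hvu : u.pos + 1 = v.pos := by
          by_contra hc
          have hvlt := v.pos_lt
          have e1 := hmono u.pos (u.pos + 1) (by omega) (by omega)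
          have e2 := hmono (u.pos + 1) v.pos (by omega) (by omega)
          rcases cross (e (u.pos + 1)) (hlt _ (by omega)) e1.le e2.le
            (hkeepsp _ (by omega) (by omega)) with hh | hh
          · have := congrArg CV.pos hh
            rw [hψpos] at this; simp at this; omega
          · have := congrArg CV.pos hh
            rw [hψpos] at this; simp at this; omega
        exact Or.inl ⟨hut, hvt, Or.inl hvu⟩
      · rw [adj_iff]
        refine Or.inr ⟨heq, fun hh => hne (CV.ext' heq hh)⟩
    intro u v
    rcases le_total u.pos v.pos with huv | huv
    · exact ⟨hfwd u v huv, hbwd u v huv⟩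
    · exact ⟨fun hh => restAdj_symm (hfwd v u huv hh.symm),
        fun hh => (hbwd v u huv (restAdj_symm hh)).symm⟩

theorem conn_rest {X : Type} (T : UTree X) (B : Set X) (S : T.V → Prop) (n : ℕ) :
    ∀ (u v : T.V) (p : T.g.Walk u v), p.IsPath → p.length ≤ n →
      (∀ w ∈ p.support, w ∈ T.spanSet B) → u ∈ T.keepSet B → v ∈ T.keepSet B →
      (∀ w ∈ p.support, S w) →
      Relation.ReflTransGen (fun x y => T.restAdj B x y ∧ S x ∧ S y) u v := by
  classical
  induction n with
  | zero =>
    intro u v p hp hl hs hu hv hS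
    have := p.eq_of_length_eq_zero (by omega)
    subst this
    exact .refl
  | succ n ih =>
    intro u v p hp hl hs hu hv hS
    by_cases huv : u = v
    · subst huv; exact .refl
    by_cases hk : ∀ w ∈ p.support, w ∈ T.keepSet B → w = u ∨ w = v
    · exact .single ⟨⟨hu, hv, huv, p, hp, hs, hk⟩, hS u p.start_mem_support, hS v p.end_mem_support⟩
    · push Not at hk
      obtain ⟨w, hw, hwk, hwu, hwv⟩ := hk
      have hlen : (p.takeUntil w hw).length + (p.dropUntil w hw).length = p.length := by
        rw [← SimpleGraph.Walk.length_append, p.take_spec hw]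
      have l1 : (p.takeUntil w hw).length ≠ 0 :=
        fun h => hwu (SimpleGraph.Walk.eq_of_length_eq_zero h).symm
      have l2 : (p.dropUntil w hw).length ≠ 0 :=
        fun h => hwv (SimpleGraph.Walk.eq_of_length_eq_zero h)
      have s1 : ∀ x ∈ (p.takeUntil w hw).support, x ∈ p.support := fun x hx =>
        p.support_takeUntil_subset_support hw hx
      have s2 : ∀ x ∈ (p.dropUntil w hw).support, x ∈ p.support := fun x hx =>
        p.support_dropUntil_subset_support hw hx
      refine (ih u w _ (hp.takeUntil hw) (by omega) (fun x hx => hs x (s1 x hx)) hu hwk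
        (fun x hx => hS x (s1 x hx))).trans
        (ih w v _ (hp.dropUntil hw) (by omega) (fun x hx => hs x (s2 x hx)) hwk hv
        (fun x hx => hS x (s2 x hx)))

theorem label_keep {X : Type} (T : UTree X) {B : Set X} {x : X} (hx : x ∈ B) :
    T.label x ∈ T.keepSet B :=
  ⟨⟨x, hx, x, hx, .nil, by simp, by simp⟩, Or.inl ⟨x, hx, rfl⟩⟩

theorem transfer {X : Type} (T T' : UTree X) (B : Set X) (φ : T.V → T'.V)
    (h1 : Set.BijOn φ (T.keepSet B) (T'.keepSet B))
    (h2 : ∀ x ∈ B, φ (T.label x) = T'.label x)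
    (h3 : ∀ u v : T.V, u ∈ T.keepSet B → v ∈ T.keepSet B →
      (T.restAdj B u v ↔ T'.restAdj B (φ u) (φ v)))
    {a b : X} (ha : a ∈ B) (hb : b ∈ B) {u : T.V} (hu : u ∈ T.keepSet B)
    (p : T.g.Walk (T.label a) (T.label b)) (hp : p.IsPath) (hup : u ∉ p.support) :
    Conn T'.g (fun w => w ≠ φ u) (T'.label a) (T'.label b) := by
  have hR := conn_rest T B (fun w => w ≠ u) p.length _ _ p hp le_rfl
    (fun w hw => ⟨a, ha, b, hb, p, hp, hw⟩) (label_keep T ha) (label_keep T hb)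
    (by rintro w hw rfl; exact hup hw)
  rw [← h2 a ha, ← h2 b hb]
  have hau : T.label a ≠ u := by rintro rfl; exact hup p.start_mem_support
  generalize T.label b = v at hR
  induction hR with
  | refl => exact Conn.refl (fun h => hau (h1.injOn (label_keep T ha) hu h))
  | @tail x y hx hxy ih =>
    refine ih.trans ?_
    obtain ⟨hr, hxu, hyu⟩ := hxy
    obtain ⟨-, -, -, q, hq, -, hqk⟩ := (h3 x y hr.1 hr.2.1).1 hr
    refine ⟨q, ?_⟩
    rintro w hw rfl
    rcases hqk _ hw (h1.mapsTo hu) with h | h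
    · exact hxu (h1.injOn hr.1 hu h.symm)
    · exact hyu (h1.injOn hr.2.1 hu h.symm)

theorem conn_box {n : ℕ} (p q : CV n) :
    Conn (G n) (fun v => min p.pos q.pos ≤ v.pos ∧ v.pos ≤ max p.pos q.pos) p q := by
  rcases le_total p.pos q.pos with h | h
  · refine (conn_path p q h).mono ?_
    rintro v (rfl | rfl | h) <;> omega
  · refine ((conn_path q p h).mono ?_).symm
    rintro v (rfl | rfl | h) <;> omega

theorem crossing2 {n : ℕ} {p q : CV n} (w : (G n).Walk p q) (k : ℕ) (hk : k < n)
    (h1 : min p.pos q.pos ≤ k) (h2 : k ≤ max p.pos q.pos) (h3 : p.pos ≠ q.pos) :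
    sp k hk ∈ w.support := by
  rcases lt_or_gt_of_ne h3 with h | h
  · exact crossing w k hk (by omega) (by omega) h
  · have := crossing w.reverse k hk (by omega) (by omega) h
    simpa using this

theorem quartet {X : Type} {n : ℕ} (hn : 2 ≤ n) (σ σ' : X ≃ Fin n) (B : Set X)
    (h : UTree.restEq (cat hn σ) (cat hn σ') B) {y a b c : X}
    (hy : y ∈ B) (ha : a ∈ B) (hb : b ∈ B) (hc : c ∈ B) (hbc : b ≠ c)
    (hT : max (σ y : ℕ) (σ a) < min (σ b : ℕ) (σ c) ∨ max (σ b : ℕ) (σ c) < min (σ y : ℕ) (σ a))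
    (hT' : ((σ' a : ℕ) < σ' b ∧ (σ' b : ℕ) < σ' y) ∨ ((σ' y : ℕ) < σ' b ∧ (σ' b : ℕ) < σ' a)) :
    False := by
  obtain ⟨φ, h1, h2, h3⟩ := h
  have hw : sp (σ' b : ℕ) (σ' b).2 ∈ (cat hn σ').keepSet B := by
    refine (mem_keep hn σ' B _).2 (Or.inr ⟨rfl, ?_⟩)
    rcases hT' with h | h
    · exact ⟨a, ha, b, hb, y, hy, h.1, h.2, rfl⟩
    · exact ⟨y, hy, b, hb, a, ha, h.1, h.2, rfl⟩
  obtain ⟨u, hu, huw⟩ := h1.surjOn hw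
  obtain ⟨p, hp, hps⟩ := conn_path_of (conn_box (lab (σ y : ℕ) (σ y).2) (lab (σ a : ℕ) (σ a).2))
  obtain ⟨q, hq, hqs⟩ := conn_path_of (conn_box (lab (σ b : ℕ) (σ b).2) (lab (σ c : ℕ) (σ c).2))
  have hor : u ∉ p.support ∨ u ∉ q.support := by
    by_contra hcon
    push Not at hcon
    have e1 := hps u hcon.1
    have e2 := hqs u hcon.2
    simp only [lab_pos] at e1 e2
    omega
  rcases hor with hh | hh
  · obtain ⟨r, hr⟩ := transfer _ _ B φ h1 h2 h3 hy ha hu p hp hh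
    refine hr _ (crossing2 (p := lab (σ' y : ℕ) (σ' y).2) (q := lab (σ' a : ℕ) (σ' a).2) r
      (σ' b : ℕ) (σ' b).2 ?_ ?_ ?_) huw.symm <;> simp only [lab_pos] <;> omega
  · obtain ⟨r, hr⟩ := transfer _ _ B φ h1 h2 h3 hb hc hu q hq hh
    have hne : (σ' b : ℕ) ≠ σ' c := fun hh => hbc (σ'.injective (Fin.ext hh))
    refine hr _ (crossing2 (p := lab (σ' b : ℕ) (σ' b).2) (q := lab (σ' c : ℕ) (σ' c).2) r
      (σ' b : ℕ) (σ' b).2 ?_ ?_ ?_) huw.symm <;> simp only [lab_pos] <;> omega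

theorem restEq_single {X : Type} (T T' : UTree X) (x : X) : UTree.restEq T T' {x} := by
  have hk : ∀ S : UTree X, S.keepSet {x} = {S.label x} := by
    intro S
    ext v
    constructor
    · rintro ⟨⟨a, ha, b, hb, p, hp, hv⟩, -⟩
      simp only [Set.mem_singleton_iff] at ha hb
      subst ha; subst hb
      rw [SimpleGraph.Walk.isPath_iff_nil, ← SimpleGraph.Walk.eq_nil_iff_nil] at hp
      subst hp
      simpa using hv
    · rintro rfl
      exact label_keep S rfl
  refine ⟨fun _ => T'.label x, ?_, ?_, ?_⟩
  · rw [hk, hk]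
    simp [Set.BijOn, Set.MapsTo, Set.InjOn, Set.SurjOn]
  · simp
  · intro u v hu hv
    rw [hk] at hu hv
    simp only [Set.mem_singleton_iff] at hu hv
    constructor
    · intro h; exact absurd (hu.trans hv.symm) h.2.2.1
    · intro h; exact absurd rfl h.2.2.1

theorem cat_inj {X : Type} {n : ℕ} (hn : 2 ≤ n) {σ σ' : X ≃ Fin n} (h : cat hn σ = cat hn σ')
    (x : X) : σ x = σ' x := by
  have hl : (fun x => lab (σ x : ℕ) (σ x).2 : X → CV n) = fun x => lab (σ' x : ℕ) (σ' x).2 := by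
    unfold cat at h
    injection h with _ _ h
  have := congrArg CV.pos (congrFun hl x)
  exact Fin.ext this

/-- position of a taxon in the `i`-th caterpillar -/
def pf (t m i : ℕ) : Fin (t + 1) ⊕ Fin m → ℕ
  | .inl j => if (j : ℕ) ≤ i then j else j + m
  | .inr c => i + 1 + (if i % 2 = 0 then (c : ℕ) else m - 1 - c)

theorem pf_lt (t m i : ℕ) (hi : i < t) (a : Fin (t + 1) ⊕ Fin m) : pf t m i a < t + 1 + m := by
  rcases a with j | c
  · have := j.2; simp only [pf]; split <;> omega
  · have := c.2; simp only [pf]; split <;> omega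

theorem pf_inj (t m i : ℕ) : Function.Injective (pf t m i) := by
  rintro (j | c) (j' | c') h
  · simp only [pf] at h
    congr 1; apply Fin.ext; split at h <;> split at h <;> omega
  · have := c'.2
    simp only [pf] at h
    split at h <;> split at h <;> omega
  · have := c.2
    simp only [pf] at h
    split at h <;> split at h <;> omega
  · have := c.2
    have := c'.2
    simp only [pf] at h
    congr 1; apply Fin.ext; split at h <;> omega

noncomputable def sig (t m i : ℕ) (hi : i < t) : (Fin (t + 1) ⊕ Fin m) ≃ Fin (t + 1 + m) :=
  Equiv.ofBijective (fun a => ⟨pf t m i a, pf_lt t m i hi a⟩) (by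
    rw [Fintype.bijective_iff_injective_and_card]
    refine ⟨fun a b h => pf_inj t m i (by simpa using h), by simp⟩)

@[simp] theorem sig_val (t m i : ℕ) (hi : i < t) (a : Fin (t + 1) ⊕ Fin m) :
    (sig t m i hi a : ℕ) = pf t m i a := rfl

theorem exists_tau {X : Type} [Finite X] {n : ℕ} (σ : X ≃ Fin n) (B : Set X) :
    ∃ τ : B ≃ Fin (Nat.card B), ∀ a b : B, τ a < τ b ↔ (σ a : ℕ) < σ b := by
  classical
  have := Fintype.ofFinite B
  let f : B → Fin n := fun b => σ b
  have hf : Function.Injective f := fun a b h => Subtype.ext (σ.injective h)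
  let _ : LinearOrder B := LinearOrder.lift' f hf
  let e := Fintype.orderIsoFinOfCardEq B (Nat.card_eq_fintype_card (α := B)).symm
  refine ⟨e.symm.toEquiv, fun a b => ?_⟩
  change e.symm a < e.symm b ↔ _
  rw [e.symm.lt_iff_lt]
  exact Iff.rfl

theorem pf_inl_lt (t m i : ℕ) (j j' : Fin (t + 1)) :
    pf t m i (.inl j) < pf t m i (.inl j') ↔ j < j' := by
  rw [Fin.lt_def]
  simp only [pf]; split <;> split <;> omega

theorem two_le_card {α : Type} [Finite α] {a b : α} (h : a ≠ b) : 2 ≤ Nat.card α :=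
  have : Nontrivial α := ⟨a, b, h⟩
  Finite.one_lt_card

theorem three_sorted {α : Type} [LinearOrder α] (s : Finset α) (h : 2 < s.card) :
    ∃ a ∈ s, ∃ b ∈ s, ∃ c ∈ s, a < b ∧ b < c := by
  obtain ⟨a, b, c, ha, hb, hc, h1, h2, h3⟩ := Finset.two_lt_card_iff.1 h
  rcases lt_or_gt_of_ne h1 with h1 | h1 <;> rcases lt_or_gt_of_ne h2 with h2 | h2 <;>
    rcases lt_or_gt_of_ne h3 with h3 | h3
  · exact ⟨a, ha, b, hb, c, hc, h1, h3⟩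
  · exact ⟨a, ha, c, hc, b, hb, h2, h3⟩
  · exact ⟨a, ha, b, hb, c, hc, h1, h3⟩
  · exact ⟨c, hc, a, ha, b, hb, h2, h1⟩
  · exact ⟨b, hb, a, ha, c, hc, h1, h2⟩
  · exact ⟨b, hb, a, ha, c, hc, h1, h2⟩
  · exact ⟨b, hb, c, hc, a, ha, h3, h2⟩
  · exact ⟨c, hc, b, hb, a, ha, h3, h1⟩

section
variable (t : ℕ)

theorem hn0 (t m : ℕ) (ht : 3 ≤ t) : 2 ≤ t + 1 + m := by omega

/-- the family of trees -/
noncomputable def fam (t : ℕ) (ht : 3 ≤ t) (m : ℕ) (i : Fin t) : UTree (Fin (t + 1) ⊕ Fin m) :=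
  cat (hn0 t m ht) (sig t m i i.2)

theorem fam_inj (t : ℕ) (ht : 3 ≤ t) (m : ℕ) (hm : 0 < m) : Function.Injective (fam t ht m) := by
  have key : ∀ i j : Fin t, i < j → fam t ht m i ≠ fam t ht m j := by
    intro i j hij h
    have := congrArg Fin.val (cat_inj _ h (.inl ⟨i + 1, by omega⟩))
    rw [Fin.lt_def] at hij
    simp only [sig_val, pf] at this
    split at this <;> split at this <;> omega
  intro i j h
  rcases lt_trichotomy i j with hh | hh | hh
  · exact absurd h (key i j hh)
  · exact hh
  · exact absurd h.symm (key j i hh)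

theorem fam_chain (t : ℕ) (ht : 3 ≤ t) (m : ℕ) (i : Fin t) :
    (fam t ht m i).IsChainIn (fun c : Fin m => Sum.inr c) := by
  intro k hk p q hp hq
  have hi := i.2
  change CV (t + 1 + m) at p q
  change (G _).Adj (lab (pf t m i (.inr ⟨k, by omega⟩)) (pf_lt t m i hi _)) p at hp
  change (G _).Adj (lab (pf t m i (.inr ⟨k + 1, hk⟩)) (pf_lt t m i hi _)) q at hq
  right
  change (G _).Adj p q
  rw [adj_iff] at *
  have h1 : 0 < pf t m i (.inr ⟨k, by omega⟩) ∧
      pf t m i (.inr ⟨k, by omega⟩) + 1 < t + 1 + m := by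
    simp only [pf]; split <;> omega
  have h2 : 0 < pf t m i (.inr ⟨k + 1, by omega⟩) ∧
      pf t m i (.inr ⟨k + 1, by omega⟩) + 1 < t + 1 + m := by
    simp only [pf]; split <;> omega
  simp only [lab_top, lab_pos, h1, h2] at hp hq
  simp at hp hq
  refine Or.inl ⟨hp.2, hq.2, ?_⟩
  rw [← hp.1, ← hq.1]
  simp only [pf]; split <;> omega

theorem lower (t : ℕ) (ht : 3 ≤ t) (F : Set (Set (Fin (t + 1) ⊕ Fin (2 * (t + 2)))))
    (hF : UTree.IsAgreementForest (Set.range (fam t ht (2 * (t + 2)))) F) : t + 2 ≤ F.ncard := by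
  classical
  by_contra hlt
  push Not at hlt
  obtain ⟨⟨hne, hpart⟩, heq, hdis⟩ := hF
  have huniq : ∀ {x B B'}, B ∈ F → B' ∈ F → x ∈ B → x ∈ B' → B = B' := by
    intro x B B' h1 h2 h3 h4
    exact (hpart x).unique ⟨h1, h3⟩ ⟨h2, h4⟩
  choose bl hbl using fun x => (hpart x).exists
  have hFfin : F.Finite := Set.toFinite F
  -- a block with three chain elements
  obtain ⟨B, hBF, hB3⟩ : ∃ B ∈ hFfin.toFinset, 2 < (Finset.univ.filter
      (fun c : Fin (2 * (t + 2)) => bl (.inr c) = B)).card := by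
    apply Finset.exists_lt_card_fiber_of_mul_lt_card_of_maps_to
    · intro c _
      simpa using (hbl (.inr c)).1
    · rw [← Set.ncard_eq_toFinset_card F hFfin]
      simp; omega
  rw [Set.Finite.mem_toFinset] at hBF
  obtain ⟨a, ha, b, hb, c, hc, hab, hbc⟩ := three_sorted _ hB3
  have hmem : ∀ {c}, c ∈ Finset.univ.filter
      (fun c : Fin (2 * (t + 2)) => bl (.inr c) = B) → (Sum.inr c : Fin (t + 1) ⊕ _) ∈ B := by
    intro c hc
    rw [← (Finset.mem_filter.1 hc).2]; exact (hbl _).2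
  replace ha := hmem ha
  replace hb := hmem hb
  replace hc := hmem hc
  rw [Fin.lt_def] at hab hbc
  have hc2 := c.2
  -- no outside taxon in the block
  have hY : ∀ j, (Sum.inl j : _ ⊕ Fin (2 * (t + 2))) ∉ B := by
    intro j hj
    have hQ : ∀ i i' : Fin t, ((j : ℕ) ≤ i ↔ (i : ℕ) % 2 = 0) →
        ¬ ((j : ℕ) ≤ i' ↔ (i' : ℕ) % 2 = 0) → False := by
      intro i i' h1 h2
      refine quartet (hn0 t _ ht) _ _ B (heq B hBF _ ⟨i, rfl⟩ _ ⟨i', rfl⟩) hj ha hb hc ?_ ?_ ?_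
      · simp only [ne_eq, Sum.inr.injEq]; rintro rfl; omega
      · simp only [sig_val, pf]
        by_cases hji : (j : ℕ) ≤ i
        · have := h1.1 hji
          simp only [hji, this, if_true]; omega
        · have : ¬ (i : ℕ) % 2 = 0 := fun h => hji (h1.2 h)
          simp only [hji, this, if_false]; omega
      · simp only [sig_val, pf]
        by_cases hji : (j : ℕ) ≤ i'
        · have : ¬ (i' : ℕ) % 2 = 0 := fun h => h2 ⟨fun _ => h, fun _ => hji⟩
          simp only [hji, this, if_true, if_false]; omega
        · have : (i' : ℕ) % 2 = 0 := by
            by_contra h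
            exact h2 ⟨fun h' => absurd h' hji, fun h' => absurd h' h⟩
          simp only [hji, this, if_true, if_false]; omega
    have h0 : 0 < t := by omega
    have h1 : 1 < t := by omega
    have h2 : 2 < t := by omega
    by_cases j0 : (j : ℕ) = 0
    · exact hQ ⟨0, h0⟩ ⟨1, h1⟩ (by grind)
        (by grind)
    by_cases j1 : (j : ℕ) = 1
    · exact hQ ⟨2, h2⟩ ⟨1, h1⟩ (by grind)
        (by grind)
    · exact hQ ⟨1, h1⟩ ⟨0, h0⟩ (by grind)
        (by grind)
  -- distinct outside taxa are in distinct blocks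
  have hD : ∀ j k : Fin (t + 1), j < k → bl (.inl j) ≠ bl (.inl k) := by
    intro j k hjk hbe
    rw [Fin.lt_def] at hjk
    have hk := k.2
    have hjt : (j : ℕ) < t := by omega
    have hB' := hbl (.inl j)
    have hkB := (hbl (.inl k)).2
    rw [← hbe] at hkB
    have hne : B ≠ bl (.inl j) := fun h => hY j (h ▸ hB'.2)
    have hd := hdis B hBF _ hB'.1 hne _ ⟨⟨j, hjt⟩, rfl⟩
    rw [Set.disjoint_left] at hd
    have hpos := pf_lt t (2 * (t + 2)) j hjt (.inr b)
    refine hd (a := sp (pf t (2 * (t + 2)) j (.inr b)) hpos) ?_ ?_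
    · refine (mem_span (hn0 t _ ht) (sig t _ j hjt) B _).2 (Or.inr ⟨rfl, ?_⟩)
      by_cases hp : (j : ℕ) % 2 = 0
      · refine ⟨_, ha, _, hc, ?_, ?_, ?_⟩ <;> simp only [sig_val, pf, sp_pos, hp, if_true] <;> omega
      · refine ⟨_, hc, _, ha, ?_, ?_, ?_⟩ <;> simp only [sig_val, pf, sp_pos, hp, if_false] <;> omega
    · refine (mem_span (hn0 t _ ht) (sig t _ j hjt) _ _).2 (Or.inr ⟨rfl, _, hB'.2, _, hkB, ?_⟩)
      have : ¬ (k : ℕ) ≤ j := by omega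
      simp only [sig_val, pf, sp_pos, this, le_refl, if_true, if_false]
      split <;> omega
  -- count
  let f : Option (Fin (t + 1)) → Set (Fin (t + 1) ⊕ Fin (2 * (t + 2))) :=
    fun o => o.elim B (fun j => bl (.inl j))
  have hf : Function.Injective f := by
    have hnb : ∀ j, B ≠ bl (.inl j) := fun j h => hY j (h ▸ (hbl (.inl j)).2)
    rintro (_ | j) (_ | k) h
    · rfl
    · exact absurd h (hnb k)
    · exact absurd h.symm (hnb j)
    · rcases lt_trichotomy j k with hh | hh | hh
      · exact absurd h (hD j k hh)
      · rw [hh]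
      · exact absurd h.symm (hD k j hh)
  have hsub : Set.range f ⊆ F := by
    rintro _ ⟨(_ | j), rfl⟩
    · exact hBF
    · exact (hbl (.inl j)).1
  have hcard := Set.ncard_le_ncard hsub hFfin
  rw [← Set.image_univ, Set.ncard_image_of_injective _ hf, Set.ncard_univ] at hcard
  simp at hcard
  omega

theorem upper (t : ℕ) (ht : 3 ≤ t) (m : ℕ) (htm : t ≤ m) (XC : Set (Fin (t + 1) ⊕ Fin m))
    (hXC : XC = {a | ¬ ∃ i : Fin m, t ≤ (i : ℕ) ∧ Sum.inr i = a}) :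
    ∃ 𝒯C : Set (UTree XC), UTree.IsRestrictionFamily (Set.range (fam t ht m)) XC 𝒯C ∧
      ∃ F, UTree.IsAgreementForest 𝒯C F ∧ F.ncard ≤ t + 1 := by
  have hl : ∀ j, (Sum.inl j : Fin (t + 1) ⊕ Fin m) ∈ XC := by intro j; rw [hXC]; simp
  have hr : ∀ c : Fin m, (Sum.inr c : Fin (t + 1) ⊕ Fin m) ∈ XC ↔ (c : ℕ) < t := by
    intro c; rw [hXC]
    constructor
    · intro h
      by_contra hc
      exact h ⟨c, by omega, rfl⟩
    · rintro h ⟨c', h1, h2⟩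
      rw [Sum.inr.inj h2] at h1; omega
  have hcard : 2 ≤ Nat.card XC := by
    refine two_le_card (a := ⟨_, hl ⟨0, by omega⟩⟩) (b := ⟨_, hl ⟨1, by omega⟩⟩) ?_
    simp
  choose τ hτ using fun i : Fin t => exists_tau (sig t m i i.2) XC
  let R : Fin t → UTree XC := fun i => cat hcard (τ i)
  have hR : ∀ i, UTree.IsRestrictionOf (fam t ht m i) XC (R i) := fun i =>
    restr_cat _ _ _ _ _ (fun a b => (hτ i a b).1)
  refine ⟨Set.range R, ⟨?_, ?_⟩, ?_⟩
  · rintro _ ⟨i, rfl⟩; exact ⟨_, ⟨i, rfl⟩, hR i⟩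
  · rintro _ ⟨i, rfl⟩; exact ⟨_, ⟨i, rfl⟩, hR i⟩
  let Y : Set XC := {a | ∃ j, a.1 = Sum.inl j}
  have hcardY : 2 ≤ Nat.card Y := by
    refine two_le_card (a := ⟨⟨_, hl ⟨0, by omega⟩⟩, _, rfl⟩) (b := ⟨⟨_, hl ⟨1, by omega⟩⟩, _, rfl⟩) ?_
    simp
  have hYlt : ∀ i i' : Fin t, ∀ a b : Y, τ i a.1 < τ i b.1 → τ i' a.1 < τ i' b.1 := by
    rintro i i' ⟨a, j, hj⟩ ⟨b, k, hk⟩ h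
    rw [hτ] at h ⊢
    simp only [hj, hk, sig_val, pf_inl_lt] at h ⊢
    exact h
  obtain ⟨ρ, hρ⟩ := exists_tau (τ ⟨0, by omega⟩) Y
  have hRY : ∀ i, UTree.IsRestrictionOf (R i) Y (cat hcardY ρ) := fun i =>
    restr_cat _ _ _ _ _ (fun a b h => hYlt _ _ a b ((hρ a b).1 h))
  let s : Fin t → XC := fun i => ⟨Sum.inr ⟨i, by omega⟩, (hr _).2 i.2⟩
  have hsY : ∀ i, s i ∉ Y := by rintro i ⟨j, hj⟩; simp [s] at hj
  refine ⟨insert Y (Set.range fun i => {s i}), ⟨⟨?_, ?_⟩, ?_, ?_⟩, ?_⟩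
  · rintro B (rfl | ⟨i, rfl⟩)
    · exact ⟨⟨_, hl 0⟩, 0, rfl⟩
    · exact Set.singleton_nonempty _
  · rintro ⟨j | c, hx⟩
    · refine ⟨Y, ⟨Or.inl rfl, j, rfl⟩, ?_⟩
      rintro B ⟨rfl | ⟨i, rfl⟩, hB⟩
      · rfl
      · have h : _ = s i := hB
        exact absurd (show s i ∈ Y from h ▸ ⟨j, rfl⟩) (hsY i)
    · have hct := (hr c).1 hx
      have hsc : (⟨Sum.inr c, hx⟩ : XC) = s ⟨c, hct⟩ := rfl
      refine ⟨{s ⟨c, hct⟩}, ⟨Or.inr ⟨_, rfl⟩, hsc⟩, ?_⟩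
      rintro B ⟨rfl | ⟨i, rfl⟩, hB⟩
      · exact absurd hB (hsY ⟨c, hct⟩)
      · have h : _ = s i := hB
        rw [← hsc, h]
  · rintro B (rfl | ⟨i, rfl⟩) _ ⟨k, rfl⟩ _ ⟨k', rfl⟩
    · exact restEq_of_restr (hRY k) (hRY k')
    · exact restEq_single _ _ _
  · have hsing : ∀ (k : Fin t) (x : XC), (R k).spanSet {x} = {(R k).label x} := by
      intro k x
      ext v
      constructor
      · rintro ⟨a, ha, b, hb, p, hp, hv⟩
        simp only [Set.mem_singleton_iff] at ha hb
        subst ha; subst hb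
        rw [SimpleGraph.Walk.isPath_iff_nil, ← SimpleGraph.Walk.eq_nil_iff_nil] at hp
        subst hp
        simpa using hv
      · rintro rfl
        exact (label_keep (R k) (Set.mem_singleton x)).1
    rintro B (rfl | ⟨i, rfl⟩) B' (rfl | ⟨i', rfl⟩) hne _ ⟨k, rfl⟩
    · exact absurd rfl hne
    · simp only [hsing]
      rw [Set.disjoint_singleton_right]
      exact fun h => hsY i' ((label_mem_span _ _ _ _).1 h)
    · simp only [hsing]
      rw [Set.disjoint_singleton_left]
      exact fun h => hsY i ((label_mem_span _ _ _ _).1 h)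
    · simp only [hsing]
      rw [Set.disjoint_singleton]
      intro h
      exact hne (congrArg _ ((R k).label_inj h))
  · refine (Set.ncard_insert_le _ _).trans ?_
    have : (Set.range fun i : Fin t => ({s i} : Set XC)).ncard ≤ t := by
      rw [← Set.image_univ]
      refine (Set.ncard_image_le).trans ?_
      simp [Set.ncard_univ]
    omega

end

end Cat
/-- **Tightness of the truncation length in `t` (unrooted).** For every `t ≥ 3` there
exist a finite taxon set `X`, a set `𝒯` of `t` unrooted binary phylogenetic trees on
`X`, and a common `m`-chain `x` of `𝒯` with `m = 2(t+2)`, such that every unrooted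
agreement forest for `𝒯` has size at least `t+2`, while the trees obtained by truncating
the chain to length `t` (restricting to `X ∖ {x_{t+1}, …, x_m}`) have an unrooted
agreement forest of size at most `t+1`. -/
theorem truncation_to_t_not_safe_unrooted (t : ℕ) (ht : 3 ≤ t) :
    ∃ (X : Type) (_ : Finite X) (𝒯 : Set (UTree X)) (x : Fin (2 * (t + 2)) → X),
      𝒯.ncard = t ∧ UTree.IsCommonChain 𝒯 x ∧
      (∀ F, UTree.IsAgreementForest 𝒯 F → t + 2 ≤ F.ncard) ∧
      ∀ XC : Set X, XC = {a : X | ¬ ∃ i : Fin (2 * (t + 2)), t ≤ (i : ℕ) ∧ x i = a} →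
        ∃ 𝒯C : Set (UTree ↥XC), UTree.IsRestrictionFamily 𝒯 XC 𝒯C ∧
          ∃ F, UTree.IsAgreementForest 𝒯C F ∧ F.ncard ≤ t + 1 := by

  refine ⟨Fin (t + 1) ⊕ Fin (2 * (t + 2)), inferInstance,
    Set.range (Cat.fam t ht (2 * (t + 2))), fun c => Sum.inr c, ?_, ⟨by omega, ?_, ?_⟩, ?_, ?_⟩
  · rw [← Set.image_univ, Set.ncard_image_of_injective _ (Cat.fam_inj t ht _ (by omega)),
      Set.ncard_univ]
    simp
  · exact Sum.inr_injective
  · rintro _ ⟨i, rfl⟩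
    exact Cat.fam_chain t ht _ i
  · exact Cat.lower t ht
  · intro XC hXC
    exact Cat.upper t ht _ (by omega) XC hXC
end
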